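/- arXiv:1911.02394 — 3 statements merged into one kernel-verified Lean document; each statement's English description precedes it below -/
import Mathlib

section
/- For integers m ≥ 3 and k ≥ 1 with m and k not in the excluded cases (m = 5 with k ∈ {2,3,5}, or m = 7 with k = 3), equality γ_dR(C_{m,k}) = 12(m+k)/11 holds if and only if m = 5 and k = 6. -/
/-- A double Roman dominating function on a simple graph `G`:
values in `{0,1,2,3}`, every vertex with value `0` has two neighbors with value `2`
or one neighbor with value `3`, and every vertex with value `1` has a neighbor with
value at least `2`. -/
def IsDRDF {V : Type*} (G : SimpleGraph V) (f : V → ℕ) : Prop :=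
  (∀ v, f v ≤ 3) ∧
  (∀ v, f v = 0 →
    (∃ u w, u ≠ w ∧ G.Adj v u ∧ G.Adj v w ∧ f u = 2 ∧ f w = 2) ∨ ∃ u, G.Adj v u ∧ f u = 3) ∧
  (∀ v, f v = 1 → ∃ u, G.Adj v u ∧ 2 ≤ f u)

/-- The double Roman domination number: the minimum weight of a DRDF. -/
noncomputable def gammaDR {V : Type*} [Fintype V] (G : SimpleGraph V) : ℕ :=
  sInf {w | ∃ f, IsDRDF G f ∧ ∑ v, f v = w}

/-- Base relation for the graph `C_{m,k}`: a cycle `x_1 ⋯ x_m x_1` (here `Fin m`, with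
`x_1` being `0`), a path `y_1 ⋯ y_k` (here `Fin k`, with `y_1` being `0` and `y_k` being
`k-1`), together with the edge `x_1 y_1`. -/
def cmkR (m k : ℕ) : (Fin m ⊕ Fin k) → (Fin m ⊕ Fin k) → Prop
  | .inl u, .inl v => (u.val + 1) % m = v.val
  | .inr i, .inr j => i.val + 1 = j.val
  | .inl u, .inr j => u.val = 0 ∧ j.val = 0
  | .inr _, .inl _ => False

/-- The graph `C_{m,k}`. -/
def Cmk (m k : ℕ) : SimpleGraph (Fin m ⊕ Fin k) := SimpleGraph.fromRel (cmkR m k)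

/-- Local condition at a vertex of value `x` with neighbours' values `p`, `q`, `r`
(missing neighbours are given the value `0`). -/
def okB (x p q r : Fin 4) : Bool :=
  match x with
  | 0 => p == 3 || q == 3 || r == 3 || (p == 2 && q == 2) || (p == 2 && r == 2) ||
      (q == 2 && r == 2)
  | 1 => decide (2 ≤ p.val) || decide (2 ≤ q.val) || decide (2 ≤ r.val)
  | _ => true

lemma cycle_bound : ∀ a0 a1 : Fin 4, ∀ a2, okB a1 a0 a2 0 → ∀ a3, okB a2 a1 a3 0 →
    ∀ a4, okB a3 a2 a4 0 → okB a4 a3 a0 0 → ∀ b0, okB a0 a1 a4 b0 →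
    (![6, 6, 5, 5] : Fin 4 → ℕ) b0 ≤
      a0.val + a1.val + a2.val + a3.val + a4.val := by
  decide +kernel

set_option synthInstance.maxHeartbeats 400000 in
set_option synthInstance.maxSize 2000 in
lemma path_bound : ∀ b5 b4 : Fin 4, okB b5 b4 0 0 → ∀ b3, okB b4 b5 b3 0 →
    ∀ b2, okB b3 b4 b2 0 → ∀ b1, okB b2 b3 b1 0 → ∀ b0, okB b1 b2 b0 0 →
    (![6, 7, 7, 8] : Fin 4 → ℕ) b0 ≤
      b0.val + b1.val + b2.val + b3.val + b4.val + b5.val := by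
  decide +kernel

instance cmkRDec (m k : ℕ) : DecidableRel (cmkR m k)
  | .inl u, .inl v => inferInstanceAs (Decidable ((u.val + 1) % m = v.val))
  | .inr i, .inr j => inferInstanceAs (Decidable (i.val + 1 = j.val))
  | .inl u, .inr j => inferInstanceAs (Decidable (u.val = 0 ∧ j.val = 0))
  | .inr _, .inl _ => inferInstanceAs (Decidable False)

instance cmkDec (m k : ℕ) : DecidableRel (Cmk m k).Adj := fun a b =>
  inferInstanceAs (Decidable (a ≠ b ∧ (cmkR m k a b ∨ cmkR m k b a)))

instance drdfDec {V : Type*} [Fintype V] [DecidableEq V] (G : SimpleGraph V)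
    [DecidableRel G.Adj] (f : V → ℕ) : Decidable (IsDRDF G f) := by
  unfold IsDRDF; infer_instance

lemma gamma_le {V : Type*} [Fintype V] {G : SimpleGraph V} {f : V → ℕ} {w : ℕ}
    (h : IsDRDF G f) (hw : ∑ v, f v ≤ w) : gammaDR G ≤ w :=
  le_trans (Nat.sInf_le (s := {w | ∃ f, IsDRDF G f ∧ ∑ v, f v = w}) ⟨f, h, rfl⟩) hw

lemma ok_of {V : Type*} {G : SimpleGraph V} {f : V → Fin 4}
    (h : IsDRDF G (fun v => (f v).val)) (v p q r : V)
    (hn : ∀ u, G.Adj v u → u = p ∨ u = q ∨ u = r) : okB (f v) (f p) (f q) (f r) := by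
  obtain ⟨-, h0, h1⟩ := h
  have h0 := h0 v
  have h1 := h1 v
  have e0 : (f v).val = 0 → okB (f v) (f p) (f q) (f r) := by
    intro hv
    have hv' : f v = 0 := Fin.ext hv
    rcases h0 hv with ⟨u, w, hne, hu, hw, fu, fw⟩ | ⟨u, hu, fu⟩
    · have fu' : f u = 2 := Fin.ext fu
      have fw' : f w = 2 := Fin.ext fw
      rcases hn u hu with rfl | rfl | rfl <;> rcases hn w hw with rfl | rfl | rfl <;>
        simp_all [okB]
    · have fu' : f u = 3 := Fin.ext fu
      rcases hn u hu with rfl | rfl | rfl <;> simp_all [okB]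
  have e1 : (f v).val = 1 → okB (f v) (f p) (f q) (f r) := by
    intro hv
    have hv' : f v = 1 := Fin.ext hv
    obtain ⟨u, hu, fu⟩ := h1 hv
    rw [hv']
    rcases hn u hu with rfl | rfl | rfl <;> simp_all [okB]
  generalize f v = x at *
  fin_cases x
  · exact e0 rfl
  · exact e1 rfl
  · rfl
  · rfl

lemma ok_of2 {V : Type*} {G : SimpleGraph V} {f : V → Fin 4}
    (h : IsDRDF G (fun v => (f v).val)) (v p q : V)
    (hn : ∀ u, G.Adj v u → u = p ∨ u = q) : okB (f v) (f p) (f q) 0 := by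
  obtain ⟨-, h0, h1⟩ := h
  have h0 := h0 v
  have h1 := h1 v
  have e0 : (f v).val = 0 → okB (f v) (f p) (f q) 0 := by
    intro hv
    have hv' : f v = 0 := Fin.ext hv
    rcases h0 hv with ⟨u, w, hne, hu, hw, fu, fw⟩ | ⟨u, hu, fu⟩
    · have fu' : f u = 2 := Fin.ext fu
      have fw' : f w = 2 := Fin.ext fw
      rcases hn u hu with rfl | rfl <;> rcases hn w hw with rfl | rfl <;>
        simp_all [okB]
    · have fu' : f u = 3 := Fin.ext fu
      rcases hn u hu with rfl | rfl <;> simp_all [okB]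
  have e1 : (f v).val = 1 → okB (f v) (f p) (f q) 0 := by
    intro hv
    have hv' : f v = 1 := Fin.ext hv
    obtain ⟨u, hu, fu⟩ := h1 hv
    rw [hv']
    rcases hn u hu with rfl | rfl <;> simp_all [okB]
  generalize f v = x at *
  fin_cases x
  · exact e0 rfl
  · exact e1 rfl
  · rfl
  · rfl

lemma ok_of1 {V : Type*} {G : SimpleGraph V} {f : V → Fin 4}
    (h : IsDRDF G (fun v => (f v).val)) (v p : V)
    (hn : ∀ u, G.Adj v u → u = p) : okB (f v) (f p) 0 0 := by
  obtain ⟨-, h0, h1⟩ := h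
  have h0 := h0 v
  have h1 := h1 v
  have e0 : (f v).val = 0 → okB (f v) (f p) 0 0 := by
    intro hv
    have hv' : f v = 0 := Fin.ext hv
    rcases h0 hv with ⟨u, w, hne, hu, hw, fu, fw⟩ | ⟨u, hu, fu⟩
    · exact absurd ((hn u hu).trans (hn w hw).symm) hne
    · have fu' : f u = 3 := Fin.ext fu
      rcases hn u hu with rfl
      simp_all [okB]
  have e1 : (f v).val = 1 → okB (f v) (f p) 0 0 := by
    intro hv
    have hv' : f v = 1 := Fin.ext hv
    obtain ⟨u, hu, fu⟩ := h1 hv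
    rw [hv']
    rcases hn u hu with rfl
    simp_all [okB]
  generalize f v = x at *
  fin_cases x
  · exact e0 rfl
  · exact e1 rfl
  · rfl
  · rfl

lemma lower56 {f : Fin 5 ⊕ Fin 6 → ℕ} (h : IsDRDF (Cmk 5 6) f) : 12 ≤ ∑ v, f v := by
  obtain ⟨g, rfl⟩ : ∃ g : Fin 5 ⊕ Fin 6 → Fin 4, f = fun v => (g v).val :=
    ⟨fun v => ⟨f v, Nat.lt_succ_of_le (h.1 v)⟩, rfl⟩
  have c := cycle_bound (g (.inl 0)) (g (.inl 1)) (g (.inl 2))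
    (ok_of2 h _ _ _ (by decide)) (g (.inl 3)) (ok_of2 h _ _ _ (by decide)) (g (.inl 4))
    (ok_of2 h _ _ _ (by decide)) (ok_of2 h _ _ _ (by decide)) (g (.inr 0))
    (ok_of h _ _ _ _ (by decide))
  have p := path_bound (g (.inr 5)) (g (.inr 4)) (ok_of1 h _ _ (by decide)) (g (.inr 3))
    (ok_of2 h _ _ _ (by decide)) (g (.inr 2)) (ok_of2 h _ _ _ (by decide)) (g (.inr 1))
    (ok_of2 h _ _ _ (by decide)) (g (.inr 0)) (ok_of2 h _ _ _ (by decide))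
  have t : ∀ b : Fin 4, 12 ≤
      (![6, 6, 5, 5] : Fin 4 → ℕ) b +
      (![6, 7, 7, 8] : Fin 4 → ℕ) b := by
    decide
  have t := t (g (.inr 0))
  simp only [Fintype.sum_sum_type, Fin.sum_univ_five, Fin.sum_univ_six]
  omega

/-- The values of an efficient function on the path with `n` vertices. -/
def pathF (n p : ℕ) : ℕ :=
  if p % 3 = 1 then 3 else if p % 3 = 0 ∧ p + 1 = n then 2 else 0

lemma pathF_sum (n : ℕ) : ∑ p ∈ Finset.range n, pathF n p ≤ n + 1 := by
  have aux : ∀ N j, j < N → ∑ p ∈ Finset.range j, pathF N p = 3 * ((j + 1) / 3) := by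
    intro N j
    induction j with
    | zero => simp
    | succ j ih =>
      intro hj
      rw [Finset.sum_range_succ, ih (by omega)]
      unfold pathF
      split_ifs <;> omega
  cases n with
  | zero => simp
  | succ n =>
    rw [Finset.sum_range_succ, aux _ _ (Nat.lt_succ_self n)]
    unfold pathF
    split_ifs <;> omega

/-- Position of a vertex of `C_{m,k}` on its Hamiltonian path. -/
def pos (m k : ℕ) : Fin m ⊕ Fin k → ℕ
  | .inl u => if u.val = 0 then m - 1 else u.val - 1
  | .inr j => m + j.val

lemma pos_surj {m k : ℕ} (hm : 3 ≤ m) {p : ℕ} (hp : p < m + k) : ∃ v, pos m k v = p := by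
  by_cases h1 : p < m - 1
  · exact ⟨.inl ⟨p + 1, by omega⟩, by simp [pos]⟩
  · by_cases h2 : p = m - 1
    · exact ⟨.inl ⟨0, by omega⟩, by simp [pos, h2]⟩
    · exact ⟨.inr ⟨p - m, by omega⟩, by simp [pos]; omega⟩

lemma pos_lt {m k : ℕ} (hm : 3 ≤ m) (v) : pos m k v < m + k := by
  rcases v with u | j
  · have := u.2
    simp only [pos]; split_ifs <;> omega
  · have := j.2
    simp only [pos]; omega

lemma pos_inj {m k : ℕ} (hm : 3 ≤ m) : Function.Injective (pos m k) := by
  rintro (u | j) (u' | j') h <;> simp only [pos] at h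
  · have := u.2
    have := u'.2
    congr 1
    apply Fin.ext
    split_ifs at h <;> omega
  · have := u.2
    split_ifs at h <;> omega
  · have := u'.2
    split_ifs at h <;> omega
  · congr 1
    apply Fin.ext
    omega

lemma pos_adj {m k : ℕ} (hm : 3 ≤ m) (v w) (h : pos m k v + 1 = pos m k w) :
    (Cmk m k).Adj v w := by
  have hne : v ≠ w := by rintro rfl; omega
  refine ⟨hne, Or.inl ?_⟩
  rcases v with u | j <;> rcases w with u' | j' <;> simp only [pos] at h <;> simp only [cmkR]
  · have := u.2
    have := u'.2
    split_ifs at h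
    · omega
    · omega
    · have e : u.val + 1 = m := by omega
      rw [e, Nat.mod_self]; omega
    · rw [Nat.mod_eq_of_lt] <;> omega
  · have := u.2
    split_ifs at h <;> omega
  · have := u'.2
    split_ifs at h <;> omega
  · omega

lemma gamma_path {m k : ℕ} (hm : 3 ≤ m) : gammaDR (Cmk m k) ≤ m + k + 1 := by
  refine gamma_le (f := fun v => pathF (m + k) (pos m k v)) ⟨?_, ?_, ?_⟩ ?_
  · intro v
    simp only [pathF]
    split_ifs <;> omega
  · intro v hv
    right
    have hlt := pos_lt hm v
    have hne : pos m k v % 3 ≠ 1 := by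
      intro h
      simp [pathF, h] at hv
    by_cases h0 : pos m k v % 3 = 0
    · have h2 : pos m k v + 1 ≠ m + k := by
        intro h
        simp [pathF, h0, h] at hv
      obtain ⟨u, hu⟩ := pos_surj hm (p := pos m k v + 1) (k := k) (by omega)
      refine ⟨u, pos_adj hm _ _ hu.symm, ?_⟩
      simp only [pathF]
      rw [if_pos (by omega)]
    · obtain ⟨u, hu⟩ := pos_surj hm (p := pos m k v - 1) (k := k) (by omega)
      refine ⟨u, (pos_adj hm _ _ (by omega)).symm, ?_⟩
      simp only [pathF]
      rw [if_pos (by omega)]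
  · intro v hv
    exfalso
    simp only [pathF] at hv
    split_ifs at hv <;> omega
  · refine le_trans (le_of_eq ?_) (pathF_sum (m + k))
    refine Finset.sum_bij (fun v _ => pos m k v) ?_ ?_ ?_ ?_
    · intro v _
      exact Finset.mem_range.2 (pos_lt hm v)
    · intro a _ b _ h
      exact pos_inj hm h
    · intro p hp
      obtain ⟨v, hv⟩ := pos_surj hm (Finset.mem_range.1 hp)
      exact ⟨v, Finset.mem_univ _, hv⟩
    · intro _ _
      rfl

lemma gamma56 : gammaDR (Cmk 5 6) = 12 := by
  refine le_antisymm (gamma_path (by norm_num)) ?_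
  obtain ⟨f, hf, hw⟩ := Nat.sInf_mem
    (s := {w | ∃ f, IsDRDF (Cmk 5 6) f ∧ ∑ v, f v = w})
    ⟨_, Sum.elim ![0, 0, 3, 0, 2] ![2, 0, 2, 0, 3, 0], by decide +kernel, rfl⟩
  unfold gammaDR
  rw [← hw]
  exact lower56 hf

lemma gamma11 (m k : ℕ) (hm : 3 ≤ m) (hk : 1 ≤ k) (h : m + k = 11) (h5 : m ≠ 5) :
    gammaDR (Cmk m k) ≤ 11 := by
  obtain rfl : k = 11 - m := by omega
  have : m ≤ 10 := by omega
  interval_cases m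
  · exact gamma_le (f := Sum.elim ![3, 0, 0] ![0, 0, 3, 0, 0, 3, 0, 2])
      (by decide +kernel) (by decide +kernel)
  · exact gamma_le (f := Sum.elim ![2, 0, 2, 0] ![0, 2, 0, 2, 0, 3, 0])
      (by decide +kernel) (by decide +kernel)
  · exact absurd rfl h5
  · exact gamma_le (f := Sum.elim ![2, 0, 2, 0, 2, 0] ![0, 2, 0, 3, 0])
      (by decide +kernel) (by decide +kernel)
  · exact gamma_le (f := Sum.elim ![3, 0, 0, 3, 0, 2, 0] ![0, 0, 3, 0])
      (by decide +kernel) (by decide +kernel)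
  · exact gamma_le (f := Sum.elim ![0, 2, 0, 2, 0, 2, 0, 2] ![0, 3, 0])
      (by decide +kernel) (by decide +kernel)
  · exact gamma_le (f := Sum.elim ![3, 0, 0, 3, 0, 0, 3, 0, 0] ![0, 2])
      (by decide +kernel) (by decide +kernel)
  · exact gamma_le (f := Sum.elim ![3, 0, 0, 3, 0, 0, 3, 0, 2, 0] ![0])
      (by decide +kernel) (by decide +kernel)

/-- For integers `m ≥ 3`, `k ≥ 1` avoiding the excluded cases (`m = 5` with
`k ∈ {2,3,5}`, and `m = 7` with `k = 3`), equality `γ_dR(C_{m,k}) = 12(m+k)/11`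
holds if and only if `m = 5` and `k = 6`. -/
theorem gammaDR_Cmk_eq_iff (m k : ℕ) (hm : 3 ≤ m) (hk : 1 ≤ k)
    (h5 : ¬ (m = 5 ∧ (k = 2 ∨ k = 3 ∨ k = 5))) (h7 : ¬ (m = 7 ∧ k = 3)) :
    (gammaDR (Cmk m k) : ℚ) = 12 * (m + k) / 11 ↔ (m = 5 ∧ k = 6) := by
  constructor
  · intro h
    have h' : 11 * gammaDR (Cmk m k) = 12 * (m + k) := by
      rw [eq_div_iff (by norm_num)] at h
      have : ((11 * gammaDR (Cmk m k) : ℕ) : ℚ) = ((12 * (m + k) : ℕ) : ℚ) := by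
        push_cast
        linarith
      exact_mod_cast this
    have hp := gamma_path (m := m) (k := k) hm
    have hs : m + k = 11 := by omega
    by_cases hm5 : m = 5
    · omega
    · have := gamma11 m k hm hk hs hm5
      omega
  · rintro ⟨rfl, rfl⟩
    rw [gamma56]
    norm_num
end

section
/- Let S be a graph, not isomorphic to Q, obtained from graphs C_{m_1,k_1}, …, C_{m_t,k_t} and cycles C_1, …, C_r, C'_1, …, C'_s, where r + s + t ≥ 2, by adding a new vertex z, joining z to the leaf y_{k_i} of each C_{m_i,k_i} (1 ≤ i ≤ t), joining z to exactly one vertex of each cycle C_i (1 ≤ i ≤ r), and identifying z with one vertex of each cycle C'_j (1 ≤ j ≤ s). Then γ_dR(S) ≤ 12·n(S)/11, where n(S) is the order of S. -/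
/-- Lift a family of relations to a relation on the sigma type (relating only elements
with the same index). -/
def sigmaRel {ι : Type} {α : ι → Type} (R : ∀ i, α i → α i → Prop) :
    (Σ i, α i) → (Σ i, α i) → Prop :=
  fun a b => ∃ h : a.1 = b.1, R b.1 (h ▸ a.2) b.2

/-- Base relation for the graph `Q`: two disjoint `5`-cycles joined by an edge
between vertex `0` of the first and vertex `0` of the second. -/
def qR : (Fin 5 ⊕ Fin 5) → (Fin 5 ⊕ Fin 5) → Prop
  | .inl u, .inl v => (u.val + 1) % 5 = v.val
  | .inr u, .inr v => (u.val + 1) % 5 = v.val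
  | .inl u, .inr v => u.val = 0 ∧ v.val = 0
  | .inr _, .inl _ => False

/-- The graph `Q`: two disjoint `5`-cycles joined by an edge. -/
def Qgraph : SimpleGraph (Fin 5 ⊕ Fin 5) := SimpleGraph.fromRel qR

/-- Vertex type of the graph `S`: a new vertex `z` (`none`), together with the graphs
`C_{m_i,k_i}` (`i < t`), the cycles `C_j` of length `c j` (`j < r`), and the cycles
`C'_j` of length `c' j` (`j < s`) in which the vertex `0` has been deleted (it is
identified with `z`). -/
abbrev SVert (t r s : ℕ) (m k : Fin t → ℕ) (c : Fin r → ℕ) (c' : Fin s → ℕ) : Type :=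
  Option ((Σ i : Fin t, Fin (m i) ⊕ Fin (k i)) ⊕
    ((Σ j : Fin r, Fin (c j)) ⊕ (Σ j : Fin s, {x : Fin (c' j) // x.val ≠ 0})))

/-- Base relation for the graph `S`: each `C_{m_i,k_i}`, each cycle `C_j`, each cycle
`C'_j` (with `z` identified with its vertex `0`), `z` joined to the leaf `y_{k_i}` of
each `C_{m_i,k_i}` and to the vertex `0` of each `C_j`. -/
def sR (t r s : ℕ) (m k : Fin t → ℕ) (c : Fin r → ℕ) (c' : Fin s → ℕ) :
    SVert t r s m k c c' → SVert t r s m k c c' → Prop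
  | none, some (.inl ⟨i, .inr j⟩) => j.val + 1 = k i
  | none, some (.inr (.inl ⟨_, x⟩)) => x.val = 0
  | none, some (.inr (.inr ⟨j, x⟩)) => x.1.val = 1 ∨ x.1.val + 1 = c' j
  | some (.inl a), some (.inl b) => sigmaRel (fun i => cmkR (m i) (k i)) a b
  | some (.inr (.inl a)), some (.inr (.inl b)) =>
      sigmaRel (fun j u v => (u.val + 1) % (c j) = v.val) a b
  | some (.inr (.inr a)), some (.inr (.inr b)) =>
      sigmaRel (fun j x y => (x.1.val + 1) % (c' j) = y.1.val) a b
  | _, _ => False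

/-- The graph `S` obtained from the `C_{m_i,k_i}`, the cycles `C_j` and the cycles
`C'_j` by adding a new vertex `z`, joining `z` to the leaf of each `C_{m_i,k_i}` and
to exactly one vertex of each `C_j`, and identifying `z` with one vertex of each
`C'_j`. -/
def Sgraph (t r s : ℕ) (m k : Fin t → ℕ) (c : Fin r → ℕ) (c' : Fin s → ℕ) :
    SimpleGraph (SVert t r s m k c c') :=
  SimpleGraph.fromRel (sR t r s m k c c')


/-- local domination condition for a vertex of value `v` with neighbours valued `a b c`. -/
def okv (v a b c : ℕ) : Prop :=
  v ≤ 3 ∧ (v = 0 → a = 3 ∨ b = 3 ∨ c = 3 ∨ (a = 2 ∧ b = 2) ∨ (a = 2 ∧ c = 2) ∨ (b = 2 ∧ c = 2)) ∧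
    (v = 1 → 2 ≤ a ∨ 2 ≤ b ∨ 2 ≤ c)

instance (v a b c : ℕ) : Decidable (okv v a b c) := by unfold okv; infer_instance

def okC (n e : ℕ) (g : ℕ → ℕ) : Prop :=
  ∀ x < n, okv (g x) (if x + 1 = n then g 0 else g (x + 1))
    (if x = 0 then g (n - 1) else g (x - 1)) (if x = 0 then e else 0)

def okS (n e : ℕ) (g : ℕ → ℕ) : Prop :=
  ∀ x < n, x ≠ 0 → okv (g x) (if x + 1 = n then e else g (x + 1))
    (if x = 1 then e else g (x - 1)) 0

def okP (k a e : ℕ) (h : ℕ → ℕ) : Prop :=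
  ∀ y < k, okv (h y) (if y + 1 = k then e else h (y + 1)) (if y = 0 then a else h (y - 1)) 0

instance (n e : ℕ) (g : ℕ → ℕ) : Decidable (okC n e g) := by unfold okC; infer_instance
instance (n e : ℕ) (g : ℕ → ℕ) : Decidable (okS n e g) := by unfold okS; infer_instance
instance (n a e : ℕ) (g : ℕ → ℕ) : Decidable (okP n a e g) := by unfold okP; infer_instance

def wt (n : ℕ) (g : ℕ → ℕ) : ℕ := ∑ x ∈ Finset.range n, g x

abbrev Idx (t r s : ℕ) := Fin t ⊕ (Fin r ⊕ Fin s)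

section
variable {t r s : ℕ} (m k : Fin t → ℕ) (c : Fin r → ℕ) (c' : Fin s → ℕ)

def gsize : Idx t r s → ℕ
  | .inl i => m i + k i
  | .inr (.inl j) => c j
  | .inr (.inr j) => c' j - 1

def LocOK (zv : ℕ) (g h : ℕ → ℕ) : Idx t r s → Prop
  | .inl i => okC (m i) (h 0) g ∧ okP (k i) (g 0) zv h
  | .inr (.inl j) => okC (c j) zv g
  | .inr (.inr j) => okS (c' j) zv g

def lw (g h : ℕ → ℕ) : Idx t r s → ℕ
  | .inl i => wt (m i) g + wt (k i) h
  | .inr (.inl j) => wt (c j) g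
  | .inr (.inr j) => wt (c' j - 1) (fun x => g (x + 1))

def fS (zv : ℕ) (F H : Idx t r s → ℕ → ℕ) : SVert t r s m k c c' → ℕ
  | none => zv
  | some (.inl ⟨i, .inl x⟩) => F (.inl i) x.val
  | some (.inl ⟨i, .inr x⟩) => H (.inl i) x.val
  | some (.inr (.inl ⟨j, x⟩)) => F (.inr (.inl j)) x.val
  | some (.inr (.inr ⟨j, x⟩)) => F (.inr (.inr j)) x.1.val

end

lemma sum_sub_fin (n : ℕ) (F : ℕ → ℕ) :
    ∑ x : {x : Fin n // x.val ≠ 0}, F x.1.val = wt (n - 1) (fun x => F (x + 1)) := by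
  unfold wt
  rcases n with _ | n
  · simp
  · rw [Nat.add_sub_cancel, Finset.sum_range]
    symm
    refine Fintype.sum_equiv
      ⟨fun i => ⟨i.succ, by simp⟩, fun x => ⟨x.1.val - 1, by have := x.1.2; have := x.2; omega⟩, ?_, ?_⟩ _ _ ?_
    · intro i; simp
    · rintro ⟨⟨x, hx⟩, h⟩
      simp at h ⊢; omega
    · intro i; simp

lemma sum_fS {t r s : ℕ} (m k : Fin t → ℕ) (c : Fin r → ℕ) (c' : Fin s → ℕ)
    (zv : ℕ) (F H : Idx t r s → ℕ → ℕ) :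
    ∑ v, fS m k c c' zv F H v = zv + ∑ i, lw m k c c' (F i) (H i) i := by
  rw [Fintype.sum_option]
  simp only [Fintype.sum_sum_type, Fintype.sum_sigma, fS, lw, sum_sub_fin]
  simp [wt, Finset.sum_range]

lemma card_S {t r s : ℕ} (m k : Fin t → ℕ) (c : Fin r → ℕ) (c' : Fin s → ℕ) :
    Fintype.card (SVert t r s m k c c') = 1 + ∑ i, gsize m k c c' i := by
  have h := sum_fS m k c c' 1 (fun _ _ => 1) (fun _ _ => 1)
  have e : fS m k c c' 1 (fun _ _ => 1) (fun _ _ => 1) = fun _ => 1 := by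
    funext v
    rcases v with _ | ⟨i, x | x⟩ | ⟨j, x⟩ | ⟨j, x⟩ <;> rfl
  rw [e] at h
  simp only [Finset.sum_const, Finset.card_univ, smul_eq_mul, mul_one] at h
  rw [h]
  congr 1
  apply Finset.sum_congr rfl
  rintro (i | j | j) _ <;> simp [lw, gsize, wt]

/-- vertexwise DRDF condition -/
def okAt {V : Type*} (G : SimpleGraph V) (f : V → ℕ) (v : V) : Prop :=
  f v ≤ 3 ∧ (f v = 0 →
    (∃ u w, u ≠ w ∧ G.Adj v u ∧ G.Adj v w ∧ f u = 2 ∧ f w = 2) ∨ ∃ u, G.Adj v u ∧ f u = 3) ∧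
  (f v = 1 → ∃ u, G.Adj v u ∧ 2 ≤ f u)

lemma okAt3 {V : Type*} {G : SimpleGraph V} {f : V → ℕ} {v u1 u2 u3 : V}
    (h1 : G.Adj v u1) (h2 : G.Adj v u2) (h3 : G.Adj v u3)
    (h12 : u1 ≠ u2) (h13 : u1 ≠ u3) (h23 : u2 ≠ u3)
    (h : okv (f v) (f u1) (f u2) (f u3)) : okAt G f v := by
  obtain ⟨ha, hb, hc⟩ := h
  refine ⟨ha, fun h0 => ?_, fun h0 => ?_⟩
  · rcases hb h0 with h | h | h | ⟨h, h'⟩ | ⟨h, h'⟩ | ⟨h, h'⟩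
    · exact .inr ⟨_, h1, h⟩
    · exact .inr ⟨_, h2, h⟩
    · exact .inr ⟨_, h3, h⟩
    · exact .inl ⟨_, _, h12, h1, h2, h, h'⟩
    · exact .inl ⟨_, _, h13, h1, h3, h, h'⟩
    · exact .inl ⟨_, _, h23, h2, h3, h, h'⟩
  · rcases hc h0 with h | h | h
    · exact ⟨_, h1, h⟩
    · exact ⟨_, h2, h⟩
    · exact ⟨_, h3, h⟩

lemma okAt2 {V : Type*} {G : SimpleGraph V} {f : V → ℕ} {v u1 u2 : V}
    (h1 : G.Adj v u1) (h2 : G.Adj v u2) (h12 : u1 ≠ u2)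
    (h : okv (f v) (f u1) (f u2) 0) : okAt G f v := by
  obtain ⟨ha, hb, hc⟩ := h
  refine ⟨ha, fun h0 => ?_, fun h0 => ?_⟩
  · rcases hb h0 with h | h | h | ⟨h, h'⟩ | ⟨h, h'⟩ | ⟨h, h'⟩
    · exact .inr ⟨_, h1, h⟩
    · exact .inr ⟨_, h2, h⟩
    · omega
    · exact .inl ⟨_, _, h12, h1, h2, h, h'⟩
    · omega
    · omega
  · rcases hc h0 with h | h | h
    · exact ⟨_, h1, h⟩
    · exact ⟨_, h2, h⟩
    · omega

section
variable {t r s : ℕ} {m k : Fin t → ℕ} {c : Fin r → ℕ} {c' : Fin s → ℕ}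

abbrev vX (i : Fin t) (x : Fin (m i)) : SVert t r s m k c c' := some (.inl ⟨i, .inl x⟩)
abbrev vY (i : Fin t) (x : Fin (k i)) : SVert t r s m k c c' := some (.inl ⟨i, .inr x⟩)
abbrev vR (j : Fin r) (x : Fin (c j)) : SVert t r s m k c c' := some (.inr (.inl ⟨j, x⟩))
abbrev vS (j : Fin s) (x : Fin (c' j)) (h : x.val ≠ 0) : SVert t r s m k c c' :=
  some (.inr (.inr ⟨j, ⟨x, h⟩⟩))

lemma adjX (i : Fin t) (x y : Fin (m i)) :
    (Sgraph t r s m k c c').Adj (vX i x) (vX i y) ↔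
      x ≠ y ∧ ((x.val + 1) % m i = y.val ∨ (y.val + 1) % m i = x.val) := by
  simp [Sgraph, vX, sR, sigmaRel, cmkR]

lemma adjXY (i : Fin t) (x : Fin (m i)) (y : Fin (k i)) :
    (Sgraph t r s m k c c').Adj (vX i x) (vY i y) ↔ x.val = 0 ∧ y.val = 0 := by
  simp [Sgraph, vX, vY, sR, sigmaRel, cmkR]

lemma adjY (i : Fin t) (x y : Fin (k i)) :
    (Sgraph t r s m k c c').Adj (vY i x) (vY i y) ↔ (x.val + 1 = y.val ∨ y.val + 1 = x.val) := by
  simp [Sgraph, vY, sR, sigmaRel, cmkR]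
  rintro h rfl
  omega

lemma adjZY (i : Fin t) (x : Fin (k i)) :
    (Sgraph t r s m k c c').Adj none (vY i x) ↔ x.val + 1 = k i := by
  simp [Sgraph, vY, sR]

lemma adjR (i : Fin r) (x y : Fin (c i)) :
    (Sgraph t r s m k c c').Adj (vR i x) (vR i y) ↔
      x ≠ y ∧ ((x.val + 1) % c i = y.val ∨ (y.val + 1) % c i = x.val) := by
  simp [Sgraph, vR, sR, sigmaRel]

lemma adjZR (i : Fin r) (x : Fin (c i)) :
    (Sgraph t r s m k c c').Adj none (vR i x) ↔ x.val = 0 := by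
  simp [Sgraph, vR, sR]

lemma adjS (i : Fin s) (x y : Fin (c' i)) (hx hy) :
    (Sgraph t r s m k c c').Adj (vS i x hx) (vS i y hy) ↔
      x ≠ y ∧ ((x.val + 1) % c' i = y.val ∨ (y.val + 1) % c' i = x.val) := by
  simp [Sgraph, vS, sR, sigmaRel]

lemma adjZS (i : Fin s) (x : Fin (c' i)) (hx) :
    (Sgraph t r s m k c c').Adj none (vS i x hx) ↔ x.val = 1 ∨ x.val + 1 = c' i := by
  simp [Sgraph, vS, sR]

end

/-- cyclic successor and predecessor -/
def nx {n : ℕ} (x : Fin n) : Fin n :=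
  ⟨if x.val + 1 = n then 0 else x.val + 1, by have := x.2; split_ifs <;> omega⟩
def pv {n : ℕ} (x : Fin n) : Fin n :=
  ⟨if x.val = 0 then n - 1 else x.val - 1, by have := x.2; split_ifs <;> omega⟩

lemma nx_mod {n : ℕ} (x : Fin n) : (x.val + 1) % n = (nx x).val := by
  have := x.2
  unfold nx
  dsimp
  split_ifs with h
  · rw [h, Nat.mod_self]
  · rw [Nat.mod_eq_of_lt (by omega)]

lemma pv_mod {n : ℕ} (x : Fin n) : ((pv x).val + 1) % n = x.val := by
  have := x.2
  unfold pv
  dsimp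
  split_ifs with h
  · rw [Nat.sub_add_cancel (by omega), Nat.mod_self, h]
  · rw [Nat.sub_add_cancel (by omega), Nat.mod_eq_of_lt x.2]

lemma nx_ne {n : ℕ} (hn : 3 ≤ n) (x : Fin n) : x ≠ nx x ∧ x ≠ pv x ∧ nx x ≠ pv x := by
  have := x.2
  simp only [ne_eq, Fin.ext_iff, nx, pv]
  split_ifs <;> omega

lemma gamma_le_s2 {t r s : ℕ} (m k : Fin t → ℕ) (c : Fin r → ℕ) (c' : Fin s → ℕ)
    (hm : ∀ i, 3 ≤ m i) (hk : ∀ i, 1 ≤ k i) (hc : ∀ j, 3 ≤ c j) (hc' : ∀ j, 3 ≤ c' j)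
    (zv : ℕ) (F H : Idx t r s → ℕ → ℕ)
    (hz : zv = 2 ∨ zv = 3 ∨ (zv = 0 ∧ ((∃ j, F (.inr (.inl j)) 0 = 3) ∨
      ∃ j j', j ≠ j' ∧ F (.inr (.inl j)) 0 = 2 ∧ F (.inr (.inl j')) 0 = 2)))
    (hF : ∀ i, LocOK m k c c' zv (F i) (H i) i) :
    gammaDR (Sgraph t r s m k c c') ≤ zv + ∑ i, lw m k c c' (F i) (H i) i := by
  apply Nat.sInf_le
  refine ⟨fS m k c c' zv F H, ?_, sum_fS m k c c' zv F H⟩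
  suffices h : ∀ v, okAt (Sgraph t r s m k c c') (fS m k c c' zv F H) v from
    ⟨fun v => (h v).1, fun v => (h v).2.1, fun v => (h v).2.2⟩
  rintro (_ | ⟨i, x | x⟩ | ⟨j, x⟩ | ⟨j, ⟨x, hx⟩⟩)
  · -- z
    rcases hz with rfl | rfl | ⟨rfl, hz⟩
    · simp [okAt, fS]
    · simp [okAt, fS]
    · refine ⟨by simp [fS], fun _ => ?_, by simp [fS]⟩
      rcases hz with ⟨j, hj⟩ | ⟨j, j', hne, h1, h2⟩
      · exact .inr ⟨vR j ⟨0, by have := hc j; omega⟩, by rw [adjZR], hj⟩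
      · exact .inl ⟨vR j ⟨0, by have := hc j; omega⟩, vR j' ⟨0, by have := hc j'; omega⟩,
          by simp [hne], by rw [adjZR], by rw [adjZR], h1, h2⟩
  · obtain ⟨h1, h2, h3⟩ := nx_ne (hm i) x
    have h := (hF (.inl i)).1 x.val x.2
    have a1 : (Sgraph t r s m k c c').Adj (vX i x) (vX i (nx x)) :=
      (adjX i _ _).2 ⟨h1, .inl (nx_mod x)⟩
    have a2 : (Sgraph t r s m k c c').Adj (vX i x) (vX i (pv x)) :=
      (adjX i _ _).2 ⟨h2, .inr (pv_mod x)⟩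
    have e1 : fS m k c c' zv F H (vX i (nx x)) =
      if x.val + 1 = m i then F (.inl i) 0 else F (.inl i) (x.val + 1) := by
      simp only [fS, nx]; split_ifs <;> rfl
    have e2 : fS m k c c' zv F H (vX i (pv x)) =
      if x.val = 0 then F (.inl i) (m i - 1) else F (.inl i) (x.val - 1) := by
      simp only [fS, pv]; split_ifs <;> rfl
    by_cases h0 : x.val = 0
    · refine okAt3 a1 a2 ((adjXY i x ⟨0, hk i⟩).2 ⟨h0, rfl⟩) (by simpa using h3) (by simp) (by simp) ?_
      rw [e1, e2]
      simp only [h0, if_true] at h ⊢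
      simpa [fS, h0] using h
    · refine okAt2 a1 a2 (by simpa using h3) ?_
      rw [e1, e2]
      simp only [h0, if_false] at h ⊢
      exact h
  · have h := (hF (.inl i)).2 x.val x.2
    have hx := x.2
    have hb : ∃ u, (Sgraph t r s m k c c').Adj (vY i x) u ∧
        fS m k c c' zv F H u = (if x.val = 0 then F (.inl i) 0 else H (.inl i) (x.val - 1)) ∧
        (u = vX i ⟨0, by have := hm i; omega⟩ ∨ u = vY i ⟨x.val - 1, by omega⟩ ∧ x.val ≠ 0) := by
      by_cases h0 : x.val = 0
      · exact ⟨vX i ⟨0, by have := hm i; omega⟩, ((adjXY i _ x).2 ⟨rfl, h0⟩).symm, by simp [fS, h0], .inl rfl⟩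
      · exact ⟨vY i ⟨x.val - 1, by omega⟩, (adjY i _ _).2 (by simp; omega), by simp [fS, h0], .inr ⟨rfl, h0⟩⟩
    obtain ⟨u, ha, he, hu⟩ := hb
    by_cases h1 : x.val + 1 = k i
    · refine okAt2 ((adjZY i x).2 h1).symm ha (by rcases hu with rfl | ⟨rfl, _⟩ <;> simp) ?_
      rw [he]
      simpa [h1, fS] using h
    · refine okAt2 ((adjY i x ⟨x.val + 1, by omega⟩).2 (by simp)) ha
        (by rcases hu with rfl | ⟨rfl, _⟩ <;> simp; omega) ?_
      rw [he]
      simpa [h1, fS] using h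
  · obtain ⟨h1, h2, h3⟩ := nx_ne (hc j) x
    have h := (hF (.inr (.inl j))) x.val x.2
    have a1 : (Sgraph t r s m k c c').Adj (vR j x) (vR j (nx x)) :=
      (adjR j _ _).2 ⟨h1, .inl (nx_mod x)⟩
    have a2 : (Sgraph t r s m k c c').Adj (vR j x) (vR j (pv x)) :=
      (adjR j _ _).2 ⟨h2, .inr (pv_mod x)⟩
    have e1 : fS m k c c' zv F H (vR j (nx x)) =
      if x.val + 1 = c j then F (.inr (.inl j)) 0 else F (.inr (.inl j)) (x.val + 1) := by
      simp only [fS, nx]; split_ifs <;> rfl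
    have e2 : fS m k c c' zv F H (vR j (pv x)) =
      if x.val = 0 then F (.inr (.inl j)) (c j - 1) else F (.inr (.inl j)) (x.val - 1) := by
      simp only [fS, pv]; split_ifs <;> rfl
    by_cases h0 : x.val = 0
    · refine okAt3 a1 a2 ((adjZR j x).2 h0).symm (by simpa using h3) (by simp) (by simp) ?_
      rw [e1, e2]
      simp only [h0, if_true] at h ⊢
      simpa [fS, h0] using h
    · refine okAt2 a1 a2 (by simpa using h3) ?_
      rw [e1, e2]
      simp only [h0, if_false] at h ⊢
      exact h
  · have h := (hF (.inr (.inr j))) x.val x.2 hx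
    have hxl := x.2
    have h3 := hc' j
    have hb : ∃ u, (Sgraph t r s m k c c').Adj (vS j x hx) u ∧
        fS m k c c' zv F H u = (if x.val = 1 then zv else F (.inr (.inr j)) (x.val - 1)) ∧
        (u = none ∧ x.val = 1 ∨ ∃ (hq : x.val - 1 ≠ 0), u = vS j ⟨x.val - 1, by omega⟩ hq) := by
      by_cases h0 : x.val = 1
      · exact ⟨none, ((adjZS j x hx).2 (.inl h0)).symm, by simp [fS, h0], .inl ⟨rfl, h0⟩⟩
      · refine ⟨vS j ⟨x.val - 1, by omega⟩ (by simp; omega), (adjS j _ _ _ _).2 ⟨?_, .inr ?_⟩, by simp [fS, h0],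
          .inr ⟨by omega, rfl⟩⟩
        · simp [Fin.ext_iff]; omega
        · simp only
          rw [Nat.sub_add_cancel (by omega), Nat.mod_eq_of_lt hxl]
    obtain ⟨u, ha, he, hu⟩ := hb
    by_cases h1 : x.val + 1 = c' j
    · refine okAt2 ((adjZS j x hx).2 (.inr h1)).symm ha
        (by rcases hu with ⟨rfl, _⟩ | ⟨_, rfl⟩ <;> simp; omega) ?_
      rw [he]
      simpa [h1, fS] using h
    · refine okAt2 ((adjS j x ⟨x.val + 1, by omega⟩ hx (by simp)).2 ⟨by simp [Fin.ext_iff], .inl ?_⟩) ha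
        (by rcases hu with ⟨rfl, _⟩ | ⟨_, rfl⟩ <;> simp; omega) ?_
      · exact Nat.mod_eq_of_lt (by omega)
      rw [he]
      simpa [h1, fS] using h

def fl (l : List ℕ) : ℕ → ℕ := fun x => l.getD x 0

lemma wt_odd (n : ℕ) : wt n (fun x => if x % 2 = 1 then 2 else 0) = 2 * (n / 2) := by
  unfold wt
  induction n with
  | zero => simp
  | succ n ih => rw [Finset.sum_range_succ, ih]; split_ifs <;> omega

lemma wt_even (n : ℕ) : wt n (fun x => if x % 2 = 0 then 2 else 0) = 2 * ((n + 1) / 2) := by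
  unfold wt
  induction n with
  | zero => simp
  | succ n ih => rw [Finset.sum_range_succ, ih]; split_ifs <;> omega

lemma wt_congr {n : ℕ} {f g : ℕ → ℕ} (h : ∀ x < n, f x = g x) : wt n f = wt n g :=
  Finset.sum_congr rfl (fun x hx => h x (Finset.mem_range.1 hx))

lemma wt_succ (n : ℕ) (f : ℕ → ℕ) : wt (n + 1) f = wt n f + f n := Finset.sum_range_succ _ _

lemma wt_succ' (n : ℕ) (f : ℕ → ℕ) : wt (n + 1) f = wt n (fun x => f (x + 1)) + f 0 :=
  Finset.sum_range_succ' _ _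

lemma exC2 (n : ℕ) (hn : 3 ≤ n) : ∃ g, okC n 2 g ∧ wt n g ≤ n := by
  rcases Nat.even_or_odd n with he | ho
  · refine ⟨fun x => if x % 2 = 1 then 2 else 0, ?_, ?_⟩
    · have := Nat.even_iff.1 he
      intro x hx
      unfold okv
      grind
    · rw [wt_odd]; omega
  · refine ⟨fun x => if x + 2 = n then 3 else if x % 2 = 1 then 2 else 0, ?_, ?_⟩
    · have := Nat.odd_iff.1 ho
      intro x hx
      unfold okv
      grind
    · have := Nat.odd_iff.1 ho
      obtain ⟨p, rfl⟩ : ∃ p, n = p + 2 := ⟨n - 2, by omega⟩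
      rw [wt_succ, wt_succ, wt_congr (g := fun x => if x % 2 = 1 then 2 else 0), wt_odd]
      · split_ifs <;> omega
      · intro x hx
        rw [if_neg (by omega)]

lemma exS2e (n : ℕ) (hn : 3 ≤ n) (he : n % 2 = 0) :
    ∃ g, g 0 = 2 ∧ okS n 2 g ∧ wt (n - 1) (fun x => g (x + 1)) + 1 ≤ n - 1 := by
  refine ⟨fun x => if x % 2 = 0 then 2 else 0, rfl, ?_, ?_⟩
  · intro x hx h0
    unfold okv
    grind
  · rw [wt_congr (g := fun x => if x % 2 = 1 then 2 else 0), wt_odd]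
    · omega
    · intro x hx
      grind

lemma exS2 (n : ℕ) (hn : 3 ≤ n) :
    ∃ g, g 0 = 2 ∧ okS n 2 g ∧ wt (n - 1) (fun x => g (x + 1)) ≤ n - 1 := by
  by_cases he : n % 2 = 0
  · obtain ⟨g, h0, h1, h2⟩ := exS2e n hn he
    exact ⟨g, h0, h1, by omega⟩
  by_cases h3 : n = 3
  · subst h3
    exact ⟨fl [2, 1, 1], by decide, by decide, by decide⟩
  obtain ⟨p, rfl⟩ : ∃ p, n = p + 5 := ⟨n - 5, by omega⟩
  refine ⟨fun x => if x = p + 4 then 1 else if x = p + 2 then 3 else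
    if x % 2 = 0 then 2 else 0, ?_, ?_, ?_⟩
  · grind
  · intro x hx h0
    unfold okv
    grind (splits := 30)
  · rw [show p + 5 - 1 = p + 1 + 1 + 1 + 1 by omega, wt_succ, wt_succ, wt_succ,
      wt_congr (g := fun x => if x % 2 = 1 then 2 else 0), wt_odd]
    · grind
    · intro x hx
      grind

lemma okS_okC {n e : ℕ} {g : ℕ → ℕ} (h0 : g 0 = 2) (h : okS n 2 g) : okC n e g := by
  intro x hx
  by_cases hx0 : x = 0
  · subst hx0
    simp [okv, h0]
  · have := h x hx hx0
    rw [h0, if_neg hx0, if_neg hx0]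
    by_cases h1 : x = 1
    · subst h1
      simpa [h0] using this
    · rw [if_neg h1] at this
      exact this

lemma exP2e (k a : ℕ) (he : k % 2 = 0) : ∃ h : ℕ → ℕ, h 0 = 2 ∧ okP k a 2 h ∧ wt k h ≤ k := by
  refine ⟨fun x => if x % 2 = 0 then 2 else 0, rfl, ?_, ?_⟩
  · intro x hx
    unfold okv
    grind
  · rw [wt_even]; omega

lemma exP2o (k : ℕ) (he : k % 2 = 1) : ∃ h : ℕ → ℕ, okP k 2 2 h ∧ wt k h + 1 ≤ k := by
  refine ⟨fun x => if x % 2 = 1 then 2 else 0, ?_, ?_⟩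
  · intro x hx
    unfold okv
    grind
  · rw [wt_odd]; omega

section
variable {t r s : ℕ} (m k : Fin t → ℕ) (c : Fin r → ℕ) (c' : Fin s → ℕ)

lemma loc2 (hm : ∀ i, 3 ≤ m i) (hc : ∀ j, 3 ≤ c j) (hc' : ∀ j, 3 ≤ c' j) (i : Idx t r s) :
    ∃ g h, LocOK m k c c' 2 g h i ∧ lw m k c c' g h i ≤ gsize m k c c' i := by
  rcases i with i | j | j
  · by_cases he : k i % 2 = 0
    · obtain ⟨g, h1, h2⟩ := exC2 (m i) (hm i)
      obtain ⟨h, h3, h4, h5⟩ := exP2e (k i) (g 0) he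
      refine ⟨g, h, ⟨by rwa [h3], h4⟩, ?_⟩
      simp only [lw, gsize]; omega
    · obtain ⟨g, h0, h1, h2⟩ := exS2 (m i) (hm i)
      obtain ⟨h, h3, h4⟩ := exP2o (k i) (by omega)
      refine ⟨g, h, ⟨okS_okC h0 h1, by rwa [h0]⟩, ?_⟩
      have := hm i
      have e := wt_succ' (m i - 1) g
      rw [Nat.sub_add_cancel (by omega)] at e
      simp only [lw, gsize]; omega
  · obtain ⟨g, h1, h2⟩ := exC2 (c j) (hc j)
    exact ⟨g, 0, h1, h2⟩
  · obtain ⟨g, _, h1, h2⟩ := exS2 (c' j) (hc' j)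
    exact ⟨g, 0, h1, h2⟩

def Good (i : Idx t r s) : Prop :=
  ∃ g h, LocOK m k c c' 2 g h i ∧ lw m k c c' g h i + 1 ≤ gsize m k c c' i

lemma goodS (j : Fin s) (h3 : 3 ≤ c' j) (he : c' j % 2 = 0) : Good m k c c' (.inr (.inr j)) := by
  obtain ⟨g, _, h1, h2⟩ := exS2e (c' j) h3 he
  exact ⟨g, 0, h1, h2⟩

lemma goodT (i : Fin t) (h3 : 3 ≤ m i) (h1 : 1 ≤ k i) (h7 : m i + k i ≤ 7) :
    Good m k c c' (.inl i) ∨ (m i = 4 ∧ k i = 2) ∨ (m i = 5 ∧ k i = 1) ∨ (m i = 5 ∧ k i = 2) := by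
  unfold Good
  simp only [LocOK, lw, gsize]
  generalize m i = a at *
  generalize k i = b at *
  have ha : a ≤ 6 := by omega
  interval_cases a
  · left
    have hb : b ≤ 4 := by omega
    interval_cases b
    · exact ⟨fl [3], fl [0], by decide, by decide⟩
    · exact ⟨fl [3], fl [0, 1], by decide, by decide⟩
    · exact ⟨fl [3], fl [0, 2, 0], by decide, by decide⟩
    · exact ⟨fl [3], fl [0, 0, 3, 0], by decide, by decide⟩
  · have hb : b ≤ 3 := by omega
    interval_cases b
    · exact .inl ⟨fl [2, 0, 2, 0], fl [0], by decide, by decide⟩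
    · simp
    · exact .inl ⟨fl [2, 0, 2, 0], fl [0, 2, 0], by decide, by decide⟩
  · right; omega
  · have hb : b = 1 := by omega
    subst hb
    exact .inl ⟨fl [3, 0, 0, 3], fl [0], by decide, by decide⟩

/-- guaranteed savings when `z` has value `3` -/
def sav : Idx t r s → ℕ
  | .inl _ => 0
  | .inr (.inl j) => if c j = 4 then 1 else 0
  | .inr (.inr j) => if c' j = 3 then 2 else 1

def TT (i : Fin t) : Prop := (m i = 4 ∧ k i = 2) ∨ (m i = 5 ∧ k i = 1) ∨ (m i = 5 ∧ k i = 2)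

lemma loc3 (hT : ∀ i, TT m k i) (hc : ∀ j, 3 ≤ c j) (hc' : ∀ j, 3 ≤ c' j)
    (i : Idx t r s) (hi : gsize m k c c' i ≤ 7) :
    ∃ g h, LocOK m k c c' 3 g h i ∧ lw m k c c' g h i + sav c c' i ≤ gsize m k c c' i := by
  rcases i with i | j | j
  · have hT := hT i
    unfold TT at hT
    simp only [LocOK, lw, gsize, sav]
    generalize m i = a at *
    generalize k i = b at *
    rcases hT with ⟨rfl, rfl⟩ | ⟨rfl, rfl⟩ | ⟨rfl, rfl⟩
    · exact ⟨fl [3, 0, 2, 0], fl [0, 0], by decide, by decide⟩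
    · exact ⟨fl [3, 0, 0, 3, 0], fl [0], by decide, by decide⟩
    · exact ⟨fl [3, 0, 0, 3, 0], fl [0, 0], by decide, by decide⟩
  · have h3 := hc j
    simp only [LocOK, lw, gsize, sav] at hi ⊢
    generalize c j = a at *
    interval_cases a
    · exact ⟨fl [0, 3, 0], 0, by decide, by decide⟩
    · exact ⟨fl [0, 0, 3, 0], 0, by decide, by decide⟩
    · exact ⟨fl [0, 2, 0, 3, 0], 0, by decide, by decide⟩
    · exact ⟨fl [3, 0, 0, 3, 0, 0], 0, by decide, by decide⟩
    · exact ⟨fl [0, 0, 3, 0, 0, 3, 0], 0, by decide, by decide⟩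
  · have h3 := hc' j
    simp only [LocOK, lw, gsize, sav] at hi ⊢
    generalize c' j = a at *
    have ha : a ≤ 8 := by omega
    interval_cases a
    · exact ⟨fl [], 0, by decide, by decide⟩
    · exact ⟨fl [0, 0, 2, 0], 0, by decide, by decide⟩
    · exact ⟨fl [0, 0, 3, 0, 0], 0, by decide, by decide⟩
    · exact ⟨fl [0, 0, 0, 3, 0, 0], 0, by decide, by decide⟩
    · exact ⟨fl [0, 0, 2, 0, 3, 0, 0], 0, by decide, by decide⟩
    · exact ⟨fl [0, 0, 3, 0, 0, 3, 0, 0], 0, by decide, by decide⟩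

def exc (i : Idx t r s) : ℕ := min 1 (gsize m k c c' i / 4)

lemma loc0 (hT : ∀ i, TT m k i) (hc : ∀ j, 3 ≤ c j) (hc' : ∀ j, c' j % 2 = 1 ∧ 5 ≤ c' j)
    (i : Idx t r s) (hi : gsize m k c c' i ≤ 7) :
    ∃ g h, LocOK m k c c' 0 g h i ∧ (gsize m k c c' i = 3 → g 0 = 3) ∧
      lw m k c c' g h i ≤ gsize m k c c' i + exc m k c c' i := by
  rcases i with i | j | j
  · have hT := hT i
    unfold TT at hT
    simp only [LocOK, lw, gsize, exc]
    generalize m i = a at *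
    generalize k i = b at *
    rcases hT with ⟨rfl, rfl⟩ | ⟨rfl, rfl⟩ | ⟨rfl, rfl⟩
    · exact ⟨fl [3, 0, 2, 0], fl [0, 2], by decide, by decide, by decide⟩
    · exact ⟨fl [3, 0, 0, 3, 0], fl [0], by decide, by decide, by decide⟩
    · exact ⟨fl [3, 0, 0, 3, 0], fl [0, 2], by decide, by decide, by decide⟩
  · have h3 := hc j
    simp only [LocOK, lw, gsize, exc] at hi ⊢
    generalize c j = a at *
    interval_cases a
    · exact ⟨fl [3, 0, 0], 0, by decide, by decide, by decide⟩
    · exact ⟨fl [2, 0, 2, 0], 0, by decide, by decide, by decide⟩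
    · exact ⟨fl [3, 0, 0, 3, 0], 0, by decide, by decide, by decide⟩
    · exact ⟨fl [3, 0, 0, 3, 0, 0], 0, by decide, by decide, by decide⟩
    · exact ⟨fl [3, 0, 0, 3, 0, 2, 0], 0, by decide, by decide, by decide⟩
  · have h3 := hc' j
    simp only [LocOK, lw, gsize, exc] at hi ⊢
    generalize c' j = a at *
    have ha : a = 5 ∨ a = 7 := by omega
    rcases ha with rfl | rfl
    · exact ⟨fl [0, 2, 0, 3, 0], 0, by decide, by decide, by decide⟩
    · exact ⟨fl [0, 0, 3, 0, 0, 3, 0], 0, by decide, by decide, by decide⟩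

end

/-- the explicit bijection onto `Q` -/
def toQ (m k : Fin 0 → ℕ) :
    SVert 0 1 1 m k (fun _ => 5) (fun _ => 5) → Fin 5 ⊕ Fin 5
  | none => .inr 0
  | some (.inl a) => a.1.elim0
  | some (.inr (.inl a)) => .inl a.2
  | some (.inr (.inr a)) => .inr a.2.1

def fromQ (m k : Fin 0 → ℕ) :
    Fin 5 ⊕ Fin 5 → SVert 0 1 1 m k (fun _ => 5) (fun _ => 5)
  | .inl x => some (.inr (.inl ⟨0, x⟩))
  | .inr x => if h : x.val = 0 then none else some (.inr (.inr ⟨0, ⟨x, h⟩⟩))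

lemma isoQ (m k : Fin 0 → ℕ) :
    Nonempty (Sgraph 0 1 1 m k (fun _ => 5) (fun _ => 5) ≃g Qgraph) := by
  refine ⟨⟨⟨toQ m k, fromQ m k, ?_, ?_⟩, ?_⟩⟩
  · rintro (_ | ⟨i, x | x⟩ | ⟨j, x⟩ | ⟨j, ⟨x, hx⟩⟩)
    · rfl
    · exact i.elim0
    · exact i.elim0
    · rw [Subsingleton.elim j 0]; rfl
    · rw [Subsingleton.elim j 0]
      simp [toQ, fromQ]
      intro h; exact (hx (by simp [h])).elim
  · rintro (x | x)
    · rfl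
    · unfold fromQ
      by_cases h : x.val = 0
      · simp [h, toQ]; ext; simp [h]
      · simp [h, toQ]
  · rintro (_ | ⟨i, x | x⟩ | ⟨j, x⟩ | ⟨j, ⟨x, hx⟩⟩) (_ | ⟨i', y | y⟩ | ⟨j', y⟩ | ⟨j', ⟨y, hy⟩⟩)
    all_goals first
      | exact i.elim0
      | exact i'.elim0
      | skip
    all_goals try rw [Subsingleton.elim j 0]
    all_goals try rw [Subsingleton.elim j' 0]
    all_goals simp [toQ, Sgraph, Qgraph, sR, qR, sigmaRel]
    · change Fin 5 at y
      decide +revert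
    · change Fin 5 at y
      rintro - rfl
      exact hy rfl
    · change Fin 5 at x
      decide +revert
    · change Fin 5 at x
      rintro - rfl
      exact hx rfl

lemma key_bound (t r s : ℕ) (m k : Fin t → ℕ) (c : Fin r → ℕ) (c' : Fin s → ℕ)
    (hm : ∀ i, 3 ≤ m i) (hk : ∀ i, 1 ≤ k i) (hc : ∀ j, 3 ≤ c j) (hc' : ∀ j, 3 ≤ c' j)
    (hrst : 2 ≤ r + s + t)
    (hQ : ¬ Nonempty (Sgraph t r s m k c c' ≃g Qgraph))
    (hn : ∑ i, gsize m k c c' i ≤ 9) :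
    gammaDR (Sgraph t r s m k c c') ≤ 1 + ∑ i, gsize m k c c' i := by
  have hG := gamma_le_s2 m k c c' hm hk hc hc'
  by_cases hgood : ∃ i, Good m k c c' i
  · obtain ⟨i₀, g₀, h₀, hl, hw⟩ := hgood
    choose g h hgl hgw using loc2 m k c c' hm hc hc'
    have hb := hG 2 (Function.update g i₀ g₀) (Function.update h i₀ h₀) (.inl rfl) (by
      intro i
      by_cases hi : i = i₀
      · subst hi; simpa using hl
      · simpa [Function.update_of_ne hi] using hgl i)
    have : ∑ i, lw m k c c' (Function.update g i₀ g₀ i) (Function.update h i₀ h₀ i) i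
        < ∑ i, gsize m k c c' i := by
      apply Finset.sum_lt_sum
      · intro i _
        by_cases hi : i = i₀
        · subst hi; simp; omega
        · simpa [Function.update_of_ne hi] using hgw i
      · exact ⟨i₀, Finset.mem_univ _, by simp; omega⟩
    omega
  -- no gadget saves with `z = 2`
  have hge2 : ∀ i, 2 ≤ gsize m k c c' i := by
    rintro (i | j | j)
    · have := hm i; simp only [gsize]; omega
    · have := hc j; simp only [gsize]; omega
    · have := hc' j; simp only [gsize]; omega
  have hpair : ∀ i j, i ≠ j → gsize m k c c' i + gsize m k c c' j ≤ 9 := by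
    intro i j hij
    have := Finset.sum_le_univ_sum_of_nonneg (s := {i, j}) (f := gsize m k c c')
      (fun _ => Nat.zero_le _)
    rw [Finset.sum_pair hij] at this
    omega
  have hcard : Fintype.card (Idx t r s) = t + (r + s) := by simp
  have hother : ∀ i : Idx t r s, ∃ j, j ≠ i := by
    intro i
    have : Nontrivial (Idx t r s) := by
      rw [← Fintype.one_lt_card_iff_nontrivial, hcard]; omega
    exact exists_ne i
  have h7 : ∀ i, gsize m k c c' i ≤ 7 := by
    intro i
    obtain ⟨j, hj⟩ := hother i
    have := hpair j i hj
    have := hge2 j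
    omega
  have hT : ∀ i, TT m k i := by
    intro i
    rcases goodT m k c c' i (hm i) (hk i) (h7 (.inl i)) with h | h
    · exact (hgood ⟨_, h⟩).elim
    · exact h
  have hodd : ∀ j, c' j % 2 = 1 := by
    intro j
    by_contra h
    exact hgood ⟨_, goodS m k c c' j (hc' j) (by omega)⟩
  -- `z = 3`
  by_cases hsav : 2 ≤ ∑ i, sav (t := t) c c' i
  · choose g h hgl hgw using fun i => loc3 m k c c' hT hc hc' i (h7 i)
    have hb := hG 3 g h (.inr (.inl rfl)) hgl
    have := Finset.sum_le_sum (s := Finset.univ) (fun i _ => hgw i)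
    rw [Finset.sum_add_distrib] at this
    omega
  have hc5 : ∀ j, c' j % 2 = 1 ∧ 5 ≤ c' j := by
    intro j
    refine ⟨hodd j, ?_⟩
    by_contra h
    have h1 := hodd j
    have h2 := hc' j
    have h3 : c' j = 3 := by omega
    have := Finset.single_le_sum (s := Finset.univ) (f := sav (t := t) c c')
      (fun _ _ => Nat.zero_le _) (Finset.mem_univ (.inr (.inr j)))
    have e : sav (t := t) c c' (.inr (.inr j)) = 2 := by simp [sav, h3]
    rw [e] at this
    exact hsav this
  -- some `C_j` is a triangle
  by_cases h3 : ∃ j, c j = 3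
  · obtain ⟨j₀, hj₀⟩ := h3
    choose g h hgl hg3 hgw using fun i => loc0 m k c c' hT hc hc5 i (h7 i)
    have hb := hG 0 g h (.inr (.inr ⟨rfl, .inl ⟨j₀, hg3 _ hj₀⟩⟩)) hgl
    have h1 := Finset.sum_le_sum (s := Finset.univ) (fun i _ => hgw i)
    rw [Finset.sum_add_distrib] at h1
    have h2 : ∑ i, 4 * exc m k c c' i + 3 ≤ ∑ i, gsize m k c c' i := by
      have hp : ∀ i ∈ Finset.univ, 4 * exc m k c c' i +
          (if i = (Sum.inr (Sum.inl j₀) : Idx t r s) then 3 else 0) ≤ gsize m k c c' i := by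
        intro i _
        split_ifs with hi
        · subst hi
          simp [exc, gsize, hj₀]
        · unfold exc
          omega
      have := Finset.sum_le_sum hp
      rw [Finset.sum_add_distrib, Finset.sum_ite_eq'] at this
      simpa using this
    rw [← Finset.mul_sum] at h2
    omega
  -- all gadgets have size at least four
  have hge4 : ∀ i, 4 ≤ gsize m k c c' i := by
    rintro (i | j | j)
    · rcases hT i with h | h | h <;> simp only [gsize] <;> omega
    · have := hc j
      have : c j ≠ 3 := fun h => h3 ⟨j, h⟩
      simp only [gsize]; omega
    · have := hc5 j; simp only [gsize]; omega
  have hcard2 : t + (r + s) ≤ 2 := by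
    have := Finset.sum_le_sum (s := Finset.univ) (fun i _ => hge4 i)
    simp only [Finset.sum_const, Finset.card_univ, hcard, smul_eq_mul] at this
    omega
  have ht : t = 0 := by
    by_contra h
    obtain ⟨j, hj⟩ := hother (.inl ⟨0, by omega⟩)
    have h1 := hpair _ _ hj
    have h2 := hge4 j
    have h3 : 6 ≤ gsize m k c c' (.inl ⟨0, by omega⟩) := by
      rcases hT ⟨0, by omega⟩ with h | h | h <;> simp only [gsize] <;> omega
    omega
  subst ht
  have hs2 : s ≤ 2 := by omega
  interval_cases s
  · obtain rfl : r = 2 := by omega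
    simp only [Fintype.sum_sum_type, Fin.sum_univ_two, sav, Finset.univ_eq_empty,
      Finset.sum_empty] at hsav
    simp [Fin.sum_univ_two, gsize] at hn
    have a0 := hge4 (.inr (.inl 0))
    have a1 := hge4 (.inr (.inl 1))
    simp only [gsize] at a0 a1
    have hcases : (c 0 = 4 ∧ c 1 = 5) ∨ (c 0 = 5 ∧ c 1 = 4) := by
      split_ifs at hsav <;> omega
    rcases hcases with ⟨b0, b1⟩ | ⟨b0, b1⟩
    · have hb := hG 0 (fun i => match i with
          | .inr (.inl 0) => fl [2, 0, 2, 0]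
          | _ => fl [2, 0, 3, 0, 1]) 0
        (.inr (.inr ⟨rfl, .inr ⟨0, 1, by decide, by decide, by decide⟩⟩)) (by
          rintro (i | j | j)
          · exact i.elim0
          · fin_cases j
            · simp only [LocOK]; simp only [Fin.zero_eta, b0]; decide
            · simp only [LocOK]; simp only [Fin.mk_one, b1]; decide
          · exact j.elim0)
      have e : ∑ i, gsize m k c c' i = 9 := by simp [Fin.sum_univ_two, gsize, b0, b1]
      simp only [Fintype.sum_sum_type, Fin.sum_univ_two, lw, b0, b1, Finset.univ_eq_empty,
        Finset.sum_empty] at hb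
      rw [e]
      exact hb.trans (by decide)
    · have hb := hG 0 (fun i => match i with
          | .inr (.inl 1) => fl [2, 0, 2, 0]
          | _ => fl [2, 0, 3, 0, 1]) 0
        (.inr (.inr ⟨rfl, .inr ⟨0, 1, by decide, by decide, by decide⟩⟩)) (by
          rintro (i | j | j)
          · exact i.elim0
          · fin_cases j
            · simp only [LocOK]; simp only [Fin.zero_eta, b0]; decide
            · simp only [LocOK]; simp only [Fin.mk_one, b1]; decide
          · exact j.elim0)
      have e : ∑ i, gsize m k c c' i = 9 := by simp [Fin.sum_univ_two, gsize, b0, b1]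
      simp only [Fintype.sum_sum_type, Fin.sum_univ_two, lw, b0, b1, Finset.univ_eq_empty,
        Finset.sum_empty] at hb
      rw [e]
      exact hb.trans (by decide)
  · obtain rfl : r = 1 := by omega
    exfalso
    simp [sav] at hsav
    simp [gsize] at hn
    have a0 := hge4 (.inr (.inl 0))
    simp only [gsize] at a0
    have a1 := hc5 0
    have b1 : c' 0 = 5 := by omega
    have b0 : c 0 = 5 := by
      by_cases b : c 0 = 4
      · simp [b, b1] at hsav
      · omega
    apply hQ
    obtain rfl : c = fun _ => 5 := by
      funext j; rw [Subsingleton.elim j 0, b0]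
    obtain rfl : c' = fun _ => 5 := by
      funext j; rw [Subsingleton.elim j 0, b1]
    exact isoQ m k
  · obtain rfl : r = 0 := by omega
    exfalso
    simp [sav, Fin.sum_univ_two] at hsav
    split_ifs at hsav <;> omega

/-- If `S ≠ Q` is obtained from graphs `C_{m_1,k_1}, …, C_{m_t,k_t}` and cycles
`C_1, …, C_r`, `C'_1, …, C'_s`, where `r + s + t ≥ 2`, by adding a new vertex `z`,
joining `z` to the leaves of the `C_{m_i,k_i}` and to exactly one vertex of each `C_i`,
and identifying `z` with one vertex of each `C'_j`, then `γ_dR(S) ≤ 12 n(S) / 11`. -/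
theorem gammaDR_S_le (t r s : ℕ) (m k : Fin t → ℕ) (c : Fin r → ℕ) (c' : Fin s → ℕ)
    (hm : ∀ i, 3 ≤ m i) (hk : ∀ i, 1 ≤ k i) (hc : ∀ j, 3 ≤ c j) (hc' : ∀ j, 3 ≤ c' j)
    (hrst : 2 ≤ r + s + t)
    (hQ : ¬ Nonempty (Sgraph t r s m k c c' ≃g Qgraph)) :
    (gammaDR (Sgraph t r s m k c c') : ℚ) ≤
      12 * (Fintype.card (SVert t r s m k c c')) / 11 := by
  have h : 11 * gammaDR (Sgraph t r s m k c c') ≤ 12 * Fintype.card (SVert t r s m k c c') := by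
    rw [card_S]
    by_cases hn : ∑ i, gsize m k c c' i ≤ 9
    · have := key_bound t r s m k c c' hm hk hc hc' hrst hQ hn
      omega
    · choose g h hgl hgw using loc2 m k c c' hm hc hc'
      have hb := gamma_le_s2 m k c c' hm hk hc hc' 2 g h (.inl rfl) hgl
      have := Finset.sum_le_sum (s := Finset.univ) (fun i _ => hgw i)
      omega
  rw [le_div_iff₀ (by norm_num)]
  have h' : (11 : ℚ) * gammaDR (Sgraph t r s m k c c') ≤
      12 * Fintype.card (SVert t r s m k c c') := by exact_mod_cast h
  linarith
end

section
/- Let G be a simple graph of order n ≥ 5 with minimum degree δ(G) ≥ 2 and with no component isomorphic to C_5 or C_7. Then γ_dR(G) ≤ 11n/10. -/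
/-- The cycle on `n` vertices (for `n ≥ 3`). -/
def cycleG (n : ℕ) : SimpleGraph (Fin n) :=
  SimpleGraph.fromRel (fun i j => (i.val + 1) % n = j.val)


namespace DR

open Classical in
/-- Neighbour finset, with classical decidability. -/
noncomputable def N {V : Type} [Fintype V] (H : SimpleGraph V) (v : V) : Finset V :=
  Finset.univ.filter (fun w => H.Adj v w)

theorem mem_N {V : Type} [Fintype V] {H : SimpleGraph V} {v w : V} :
    w ∈ N H v ↔ H.Adj v w := by simp [N]

/-- The local condition of a double Roman dominating function at the vertex `y`. -/
def Good {V : Type} (H : SimpleGraph V) (f : V → ℕ) (y : V) : Prop :=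
  f y ≤ 3 ∧
  (f y = 0 → (∃ u w, u ≠ w ∧ H.Adj y u ∧ H.Adj y w ∧ f u = 2 ∧ f w = 2) ∨
    ∃ u, H.Adj y u ∧ f u = 3) ∧
  (f y = 1 → ∃ u, H.Adj y u ∧ 2 ≤ f u)

theorem Good.congr {V : Type} {H : SimpleGraph V} {f f' : V → ℕ} {y : V}
    (h : Good H f y) (hy : f' y = f y) (hn : ∀ w, H.Adj y w → f' w = f w) : Good H f' y := by
  obtain ⟨h1, h2, h3⟩ := h
  refine ⟨by omega, ?_, ?_⟩
  · intro h0
    rcases h2 (by omega) with ⟨u, w, huw, hu, hw, fu, fw⟩ | ⟨u, hu, fu⟩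
    · exact Or.inl ⟨u, w, huw, hu, hw, by rw [hn u hu, fu], by rw [hn w hw, fw]⟩
    · exact Or.inr ⟨u, hu, by rw [hn u hu, fu]⟩
  · intro h0
    obtain ⟨u, hu, fu⟩ := h3 (by omega)
    exact ⟨u, hu, by rw [hn u hu]; exact fu⟩

/-- A union of components of `H - B` together with an economical labelling. -/
def Piece {V : Type} [Fintype V] (H : SimpleGraph V) (B : Finset V) (g W : V → ℕ)
    (C : Finset V) : Prop :=
  (∀ y ∈ C, ∀ w, H.Adj y w → w ∈ C ∨ w ∈ B) ∧ (∀ y ∈ C, y ∉ B) ∧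
  ∃ f : V → ℕ, (∀ v ∈ B, f v = g v) ∧ (∀ y ∈ C, Good H f y) ∧
    20 * ∑ y ∈ C, f y + ∑ y ∈ C, W y ≤ 22 * C.card

open Classical in
theorem piece_merge {V : Type} [Fintype V] (H : SimpleGraph V) (B : Finset V) (g W : V → ℕ)
    (hS : ∀ S : Finset V, S.Nonempty → (∀ y ∈ S, y ∉ B) →
      (∀ y ∈ S, ∀ w, H.Adj y w → w ∈ S ∨ w ∈ B) → ∃ C ⊆ S, C.Nonempty ∧ Piece H B g W C) :
    ∀ (n : ℕ) (S : Finset V), S.card = n → (∀ y ∈ S, y ∉ B) →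
      (∀ y ∈ S, ∀ w, H.Adj y w → w ∈ S ∨ w ∈ B) → Piece H B g W S := by
  intro n
  induction n using Nat.strong_induction_on with
  | _ n ih =>
    intro S hSn hSB hcl
    rcases S.eq_empty_or_nonempty with rfl | hne
    · exact ⟨by simp, by simp, g, by simp, by simp, by simp⟩
    obtain ⟨C, hCS, hCne, hC1, hC2, f, hf1, hf2, hf3⟩ := hS S hne hSB hcl
    have hcard : (S \ C).card < n := by
      rw [← hSn]
      exact Finset.card_lt_card (Finset.sdiff_ssubset hCS hCne)
    have hcl' : ∀ y ∈ S \ C, ∀ w, H.Adj y w → w ∈ S \ C ∨ w ∈ B := by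
      intro y hy w hyw
      rw [Finset.mem_sdiff] at hy
      rcases hcl y hy.1 w hyw with h | h
      · by_cases hw : w ∈ C
        · rcases hC1 w hw y hyw.symm with h' | h'
          · exact absurd h' hy.2
          · exact absurd h' (hSB y hy.1)
        · exact Or.inl (Finset.mem_sdiff.2 ⟨h, hw⟩)
      · exact Or.inr h
    obtain ⟨_, _, f', hf1', hf2', hf3'⟩ := ih _ hcard (S \ C) rfl
      (fun y hy => hSB y (Finset.mem_sdiff.1 hy).1) hcl'
    refine ⟨hcl, hSB, fun y => if y ∈ C then f y else f' y, ?_, ?_, ?_⟩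
    · intro v hv
      have : v ∉ C := fun h => hC2 v h hv
      simp [this, hf1' v hv]
    · intro y hy
      by_cases hyC : y ∈ C
      · refine (hf2 y hyC).congr (by simp [hyC]) ?_
        intro w hw
        rcases hC1 y hyC w hw with h | h
        · simp [h]
        · have : w ∉ C := fun h' => hC2 w h' h
          simp [this, hf1' w h, hf1 w h]
      · refine (hf2' y (Finset.mem_sdiff.2 ⟨hy, hyC⟩)).congr (by simp [hyC]) ?_
        intro w hw
        rcases hcl' y (Finset.mem_sdiff.2 ⟨hy, hyC⟩) w hw with h | h
        · simp [(Finset.mem_sdiff.1 h).2]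
        · have : w ∉ C := fun h' => hC2 w h' h
          simp [this]
    · have e1 : ∑ y ∈ S, (if y ∈ C then f y else f' y) = ∑ y ∈ C, f y + ∑ y ∈ S \ C, f' y := by
        rw [← Finset.sum_sdiff hCS, add_comm]
        congr 1
        · exact Finset.sum_congr rfl (fun y hy => by simp [hy])
        · exact Finset.sum_congr rfl (fun y hy => by simp [(Finset.mem_sdiff.1 hy).2])
      have e2 : ∑ y ∈ S, W y = ∑ y ∈ C, W y + ∑ y ∈ S \ C, W y := by
        rw [← Finset.sum_sdiff hCS, add_comm]
      have e3 : S.card = C.card + (S \ C).card := by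
        rw [Finset.card_sdiff_of_subset hCS]
        have := Finset.card_le_card hCS
        omega
      rw [e1, e2, e3]
      omega

/-- Labelling a sequence by a pattern. -/
theorem exists_label {V : Type} (x : ℕ → V) (k : ℕ) (hinj : Set.InjOn x (Set.Icc 1 k))
    (p : ℕ → ℕ) (g : V → ℕ) : ∃ f : V → ℕ, (∀ i, 1 ≤ i → i ≤ k → f (x i) = p i) ∧
      ∀ y, (∀ i, 1 ≤ i → i ≤ k → x i ≠ y) → f y = g y := by
  classical
  refine ⟨fun y => if h : ∃ i, 1 ≤ i ∧ i ≤ k ∧ x i = y then p h.choose else g y, ?_, ?_⟩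
  · intro i h1 h2
    have h : ∃ j, 1 ≤ j ∧ j ≤ k ∧ x j = x i := ⟨i, h1, h2, rfl⟩
    have hs := h.choose_spec
    have : h.choose = i := hinj ⟨hs.1, hs.2.1⟩ ⟨h1, h2⟩ hs.2.2
    simp only [h, dif_pos]
    rw [this]
  · intro y hy
    beta_reduce
    rw [dif_neg]
    rintro ⟨i, h1, h2, h3⟩
    exact hy i h1 h2 h3

open Classical in
/-- A sequence of distinct vertices with a labelling pattern is a piece. -/
theorem seq_piece {V : Type} [Fintype V] (H : SimpleGraph V) (B : Finset V) (g W : V → ℕ)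
    (k : ℕ) (x : ℕ → V) (hinj : Set.InjOn x (Set.Icc 1 k))
    (hB : ∀ i, 1 ≤ i → i ≤ k → x i ∉ B)
    (hcl : ∀ i, 1 ≤ i → i ≤ k → ∀ w, H.Adj (x i) w → (∃ j, 1 ≤ j ∧ j ≤ k ∧ w = x j) ∨ w ∈ B)
    (p : ℕ → ℕ)
    (hgood : ∀ f : V → ℕ, (∀ i, 1 ≤ i → i ≤ k → f (x i) = p i) → (∀ v ∈ B, f v = g v) →
      ∀ i, 1 ≤ i → i ≤ k → Good H f (x i))
    (hcost : 20 * ∑ i ∈ Finset.Icc 1 k, p i + ∑ i ∈ Finset.Icc 1 k, W (x i) ≤ 22 * k) :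
    Piece H B g W ((Finset.Icc 1 k).image x) := by
  obtain ⟨f, hf1, hf2⟩ := exists_label x k hinj p g
  have hfB : ∀ v ∈ B, f v = g v := by
    intro v hv
    refine hf2 v ?_
    rintro i h1 h2 rfl
    exact hB i h1 h2 hv
  have hinj' : Set.InjOn x (Finset.Icc 1 k : Finset ℕ) := by simpa using hinj
  refine ⟨?_, ?_, f, hfB, ?_, ?_⟩
  · intro y hy w hw
    obtain ⟨i, hi, rfl⟩ := Finset.mem_image.1 hy
    rw [Finset.mem_Icc] at hi
    rcases hcl i hi.1 hi.2 w hw with ⟨j, h1, h2, rfl⟩ | h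
    · exact Or.inl (Finset.mem_image.2 ⟨j, Finset.mem_Icc.2 ⟨h1, h2⟩, rfl⟩)
    · exact Or.inr h
  · intro y hy
    obtain ⟨i, hi, rfl⟩ := Finset.mem_image.1 hy
    rw [Finset.mem_Icc] at hi
    exact hB i hi.1 hi.2
  · intro y hy
    obtain ⟨i, hi, rfl⟩ := Finset.mem_image.1 hy
    rw [Finset.mem_Icc] at hi
    exact hgood f hf1 hfB i hi.1 hi.2
  · rw [Finset.sum_image hinj', Finset.sum_image hinj', Finset.card_image_of_injOn hinj']
    have : ∑ i ∈ Finset.Icc 1 k, f (x i) = ∑ i ∈ Finset.Icc 1 k, p i :=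
      Finset.sum_congr rfl (fun i hi => by
        rw [Finset.mem_Icc] at hi
        exact hf1 i hi.1 hi.2)
    rw [this]
    simpa using hcost

/-- The alternating pattern. -/
theorem sum_alt (m : ℕ) : ∑ i ∈ Finset.Icc 1 (2 * m), (if i % 2 = 0 then 2 else 0) = 2 * m := by
  induction m with
  | zero => simp
  | succ m ih =>
    rw [show 2 * (m + 1) = 2 * m + 1 + 1 by ring, Finset.sum_Icc_succ_top (by omega),
      Finset.sum_Icc_succ_top (by omega), ih, if_neg (by omega), if_pos (by omega)]

theorem sum_alt' (m : ℕ) :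
    ∑ i ∈ Finset.Icc 1 (2 * m), (if i % 2 = 1 then 2 else 0) = 2 * m := by
  induction m with
  | zero => simp
  | succ m ih =>
    rw [show 2 * (m + 1) = 2 * m + 1 + 1 by ring, Finset.sum_Icc_succ_top (by omega),
      Finset.sum_Icc_succ_top (by omega), ih, if_pos (by omega), if_neg (by omega)]

/-- Interior sums that only see the two ends. -/
theorem sum_ends (k : ℕ) (hk : 2 ≤ k) (w : ℕ → ℕ) (h : ∀ i, 1 < i → i < k → w i = 0) :
    ∑ i ∈ Finset.Icc 1 k, w i = w 1 + w k := by
  rw [Finset.sum_eq_add_of_mem 1 k (by simp; omega) (by simp; omega) (by omega)]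
  intro c hc hne
  rw [Finset.mem_Icc] at hc
  exact h c (by omega) (by omega)

/-- Data of a thread `x 1, …, x k` between `x 0` and `x (k+1)`. -/
structure Thread {V : Type} (H : SimpleGraph V) (B : Finset V) (k : ℕ) (x : ℕ → V) : Prop where
  inj : Set.InjOn x (Set.Icc 1 k)
  notB : ∀ i, 1 ≤ i → i ≤ k → x i ∉ B
  left : x 0 ∈ B
  right : x (k + 1) ∈ B
  nbr : ∀ i, 1 ≤ i → i ≤ k → ∀ w, H.Adj (x i) w ↔ w = x (i - 1) ∨ w = x (i + 1)
  ne : ∀ i, 1 ≤ i → i ≤ k → x (i - 1) ≠ x (i + 1)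

theorem Thread.cl {V : Type} {H : SimpleGraph V} {B : Finset V} {k : ℕ} {x : ℕ → V}
    (T : Thread H B k x) : ∀ i, 1 ≤ i → i ≤ k → ∀ w, H.Adj (x i) w →
      (∃ j, 1 ≤ j ∧ j ≤ k ∧ w = x j) ∨ w ∈ B := by
  intro i h1 h2 w hw
  rcases (T.nbr i h1 h2 w).1 hw with rfl | rfl
  · by_cases h : i = 1
    · subst h; exact Or.inr T.left
    · exact Or.inl ⟨i - 1, by omega, by omega, rfl⟩
  · by_cases h : i = k
    · subst h; exact Or.inr T.right
    · exact Or.inl ⟨i + 1, by omega, by omega, rfl⟩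

theorem Thread.rev {V : Type} {H : SimpleGraph V} {B : Finset V} {k : ℕ} {x : ℕ → V}
    (T : Thread H B k x) : Thread H B k (fun i => x (k + 1 - i)) where
  inj := by
    intro i hi j hj hij
    have := T.inj (x₁ := k + 1 - i) (x₂ := k + 1 - j) ⟨by have := hi.2; omega, by have := hi.1; omega⟩
      ⟨by have := hj.2; omega, by have := hj.1; omega⟩ hij
    have := hi.2; have := hj.2
    omega
  notB := fun i h1 h2 => T.notB _ (by omega) (by omega)
  left := T.right
  right := by simpa using T.left
  nbr := by
    intro i h1 h2 w
    have := T.nbr (k + 1 - i) (by omega) (by omega) w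
    rw [show k + 1 - (i - 1) = k + 1 - i + 1 by omega, show k + 1 - (i + 1) = k + 1 - i - 1 by omega]
    tauto
  ne := by
    intro i h1 h2
    have := T.ne (k + 1 - i) (by omega) (by omega)
    rw [show k + 1 - (i - 1) = k + 1 - i + 1 by omega, show k + 1 - (i + 1) = k + 1 - i - 1 by omega]
    exact this.symm

open Classical in
theorem thread_one {V : Type} [Fintype V] {H : SimpleGraph V} {B : Finset V} {g W : V → ℕ}
    {x : ℕ → V} (T : Thread H B 1 x) (hg : ∀ v ∈ B, g v = 2 ∨ g v = 3)
    (hW : W (x 1) ≤ 22) : Piece H B g W ((Finset.Icc 1 1).image x) := by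
  refine seq_piece H B g W 1 x T.inj T.notB T.cl (fun _ => 0) ?_ (by simpa using hW)
  intro f hf1 hf2 i h1 h2
  obtain rfl : i = 1 := by omega
  have f1 := hf1 1 le_rfl le_rfl
  have a0 : H.Adj (x 1) (x 0) := (T.nbr 1 le_rfl le_rfl _).2 (Or.inl rfl)
  have a2 : H.Adj (x 1) (x 2) := (T.nbr 1 le_rfl le_rfl _).2 (Or.inr rfl)
  refine ⟨by omega, fun _ => ?_, fun h => by omega⟩
  have e0 := hf2 _ T.left
  have e2 := hf2 _ T.right
  rcases hg _ T.left with h | h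
  · rcases hg _ T.right with h' | h'
    · exact Or.inl ⟨x 0, x 2, T.ne 1 le_rfl le_rfl, a0, a2, by omega, by simp at e2 h'; omega⟩
    · exact Or.inr ⟨x 2, a2, by simp at e2 h'; omega⟩
  · exact Or.inr ⟨x 0, a0, by omega⟩

open Classical in
theorem thread_two {V : Type} [Fintype V] {H : SimpleGraph V} {B : Finset V} {g W : V → ℕ}
    {x : ℕ → V} (T : Thread H B 2 x) (hg0 : g (x 0) = 3) (hg3 : g (x 3) = 3)
    (hW : W (x 1) ≤ 22) (hW2 : W (x 2) ≤ 22) :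
    Piece H B g W ((Finset.Icc 1 2).image x) := by
  refine seq_piece H B g W 2 x T.inj T.notB T.cl (fun _ => 0) ?_ ?_
  · intro f hf1 hf2 i h1 h2
    have e0 := hf2 _ T.left
    have e3 := hf2 _ T.right
    have fi := hf1 i h1 h2
    refine ⟨by omega, fun _ => Or.inr ?_, fun h => by omega⟩
    by_cases h : i = 1
    · subst h
      exact ⟨x 0, (T.nbr 1 le_rfl h2 _).2 (Or.inl rfl), by omega⟩
    · obtain rfl : i = 2 := by omega
      exact ⟨x 3, (T.nbr 2 h1 h2 _).2 (Or.inr rfl), by simp at e3; omega⟩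
  · rw [sum_ends 2 le_rfl (fun i => W (x i)) (fun i _ _ => by omega)]
    simp
    omega

open Classical in
theorem thread_long {V : Type} [Fintype V] {H : SimpleGraph V} {B : Finset V} {g W : V → ℕ}
    {k : ℕ} {x : ℕ → V} (hk : 3 ≤ k) (T : Thread H B k x) (hg : ∀ v ∈ B, g v = 2 ∨ g v = 3)
    (hW0 : ∀ i, 1 < i → i < k → W (x i) = 0)
    (hW1 : W (x 1) ≤ if g (x 0) = 3 then 13 else 4)
    (hWk : W (x k) ≤ if g (x (k + 1)) = 3 then 13 else 4)
    (hor : g (x (k + 1)) = 3 ∨ g (x 0) = 2) :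
    Piece H B g W ((Finset.Icc 1 k).image x) := by
  have hsum : ∑ i ∈ Finset.Icc 1 k, W (x i) = W (x 1) + W (x k) :=
    sum_ends k (by omega) (fun i => W (x i)) hW0
  have hW1' : W (x 1) ≤ 13 := hW1.trans (by split_ifs <;> omega)
  have hWk' : W (x k) ≤ 13 := hWk.trans (by split_ifs <;> omega)
  have adl : ∀ i, 1 ≤ i → i ≤ k → H.Adj (x i) (x (i - 1)) :=
    fun i h1 h2 => (T.nbr i h1 h2 _).2 (Or.inl rfl)
  have adr : ∀ i, 1 ≤ i → i ≤ k → H.Adj (x i) (x (i + 1)) :=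
    fun i h1 h2 => (T.nbr i h1 h2 _).2 (Or.inr rfl)
  have g0 := hg _ T.left
  have gk := hg _ T.right
  -- a zero between two vertices of label at least two
  have key : ∀ (f : V → ℕ) (i : ℕ), 1 ≤ i → i ≤ k → f (x i) = 0 →
      (f (x (i - 1)) = 2 ∨ f (x (i - 1)) = 3) → (f (x (i + 1)) = 2 ∨ f (x (i + 1)) = 3) →
      Good H f (x i) := by
    intro f i h1 h2 h0 ha hb
    refine ⟨by omega, fun _ => ?_, fun h => by omega⟩
    rcases ha with ha | ha
    · rcases hb with hb | hb
      · exact Or.inl ⟨_, _, T.ne i h1 h2, adl i h1 h2, adr i h1 h2, ha, hb⟩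
      · exact Or.inr ⟨_, adr i h1 h2, hb⟩
    · exact Or.inr ⟨_, adl i h1 h2, ha⟩
  have big : ∀ (f : V → ℕ) (i : ℕ), f (x i) = 2 → Good H f (x i) :=
    fun f i h => ⟨by omega, fun h => by omega, fun h => by omega⟩
  rcases Nat.even_or_odd' k with ⟨m, rfl | rfl⟩
  · by_cases h3 : g (x (2 * m + 1)) = 3
    · refine seq_piece H B g W _ x T.inj T.notB T.cl
        (fun i => if i = 2 * m - 1 then 1 else if i = 2 * m then 0 else
          if i % 2 = 0 then 2 else 0) ?_ ?_
      · intro f hf1 hf2 i h1 h2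
        have e0 := hf2 _ T.left
        have ek := hf2 _ T.right
        have fi := hf1 i h1 h2
        by_cases c1 : i = 2 * m - 1
        · rw [if_pos c1] at fi
          refine ⟨by omega, fun h => by omega, fun _ => ⟨_, adl i h1 h2, ?_⟩⟩
          rw [hf1 (i - 1) (by omega) (by omega), if_neg (by omega), if_neg (by omega),
            if_pos (by omega)]
        · rw [if_neg c1] at fi
          by_cases c2 : i = 2 * m
          · rw [if_pos c2] at fi
            refine ⟨by omega, fun _ => Or.inr ⟨_, adr i h1 h2, ?_⟩, fun h => by omega⟩
            rw [c2, ek, h3]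
          · rw [if_neg c2] at fi
            by_cases c3 : i % 2 = 0
            · rw [if_pos c3] at fi
              exact big f i fi
            · rw [if_neg c3] at fi
              refine key f i h1 h2 fi ?_ ?_
              · by_cases c4 : i = 1
                · subst c4
                  simp only [Nat.sub_self, e0]
                  exact g0
                · left
                  rw [hf1 (i - 1) (by omega) (by omega), if_neg (by omega), if_neg (by omega),
                    if_pos (by omega)]
              · left
                rw [hf1 (i + 1) (by omega) (by omega), if_neg (by omega), if_neg (by omega),
                    if_pos (by omega)]
      · obtain ⟨j, rfl⟩ : ∃ j, m = j + 1 := ⟨m - 1, by omega⟩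
        have : ∑ i ∈ Finset.Icc 1 (2 * (j + 1)), (if i = 2 * (j + 1) - 1 then 1 else
          if i = 2 * (j + 1) then 0 else if i % 2 = 0 then 2 else 0) = 2 * j + 1 := by
          rw [show 2 * (j + 1) = 2 * j + 1 + 1 by ring, Finset.sum_Icc_succ_top (by omega),
            Finset.sum_Icc_succ_top (by omega), if_pos (by omega), if_neg (by omega),
            if_pos rfl, add_zero]
          congr 1
          conv_rhs => rw [← sum_alt j]
          refine Finset.sum_congr rfl (fun i hi => ?_)
          rw [Finset.mem_Icc] at hi
          rw [if_neg (by omega), if_neg (by omega)]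
        rw [this, hsum]
        omega
    · have h2 : g (x (2 * m + 1)) = 2 := by omega
      have h02 : g (x 0) = 2 := by omega
      rw [if_neg (by omega)] at hWk hW1
      refine seq_piece H B g W _ x T.inj T.notB T.cl
        (fun i => if i = 2 * m - 1 ∨ i = 2 * m then 1 else
          if i % 2 = 0 then 2 else 0) ?_ ?_
      · intro f hf1 hf2 i h1 h2
        have e0 := hf2 _ T.left
        have ek := hf2 _ T.right
        have fi := hf1 i h1 h2
        by_cases c1 : i = 2 * m - 1
        · rw [if_pos (Or.inl c1)] at fi
          refine ⟨by omega, fun h => by omega, fun _ => ⟨_, adl i h1 h2, ?_⟩⟩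
          rw [hf1 (i - 1) (by omega) (by omega), if_neg (by omega), if_pos (by omega)]
        · by_cases c2 : i = 2 * m
          · rw [if_pos (Or.inr c2)] at fi
            refine ⟨by omega, fun h => by omega, fun _ => ⟨_, adr i h1 h2, ?_⟩⟩
            rw [c2, ek]
            omega
          · rw [if_neg (by omega)] at fi
            by_cases c3 : i % 2 = 0
            · rw [if_pos c3] at fi
              exact big f i fi
            · rw [if_neg c3] at fi
              refine key f i h1 h2 fi ?_ ?_
              · by_cases c4 : i = 1
                · subst c4
                  simp only [Nat.sub_self, e0]
                  exact g0
                · left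
                  rw [hf1 (i - 1) (by omega) (by omega), if_neg (by omega), if_pos (by omega)]
              · left
                rw [hf1 (i + 1) (by omega) (by omega), if_neg (by omega), if_pos (by omega)]
      · obtain ⟨j, rfl⟩ : ∃ j, m = j + 1 := ⟨m - 1, by omega⟩
        have : ∑ i ∈ Finset.Icc 1 (2 * (j + 1)), (if i = 2 * (j + 1) - 1 ∨ i = 2 * (j + 1)
            then 1 else if i % 2 = 0 then 2 else 0) = 2 * j + 1 + 1 := by
          rw [show 2 * (j + 1) = 2 * j + 1 + 1 by ring, Finset.sum_Icc_succ_top (by omega),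
            Finset.sum_Icc_succ_top (by omega), if_pos (by omega), if_pos (by omega)]
          congr 2
          conv_rhs => rw [← sum_alt j]
          refine Finset.sum_congr rfl (fun i hi => ?_)
          rw [Finset.mem_Icc] at hi
          rw [if_neg (by omega)]
        rw [this, hsum]
        omega
  · refine seq_piece H B g W _ x T.inj T.notB T.cl
        (fun i => if i % 2 = 0 then 2 else 0) ?_ ?_
    · intro f hf1 hf2 i h1 h2
      have e0 := hf2 _ T.left
      have ek := hf2 _ T.right
      have fi := hf1 i h1 h2
      by_cases c3 : i % 2 = 0
      · rw [if_pos c3] at fi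
        exact big f i fi
      · rw [if_neg c3] at fi
        refine key f i h1 h2 fi ?_ ?_
        · by_cases c4 : i = 1
          · subst c4
            simp only [Nat.sub_self, e0]
            exact g0
          · left
            rw [hf1 (i - 1) (by omega) (by omega), if_pos (by omega)]
        · by_cases c4 : i = 2 * m + 1
          · subst c4
            rw [ek]
            exact gk
          · left
            rw [hf1 (i + 1) (by omega) (by omega), if_pos (by omega)]
    · rw [Finset.sum_Icc_succ_top (by omega), sum_alt, if_neg (by omega), hsum]
      omega

open Classical in
/-- Cycle components. -/
theorem cycle_piece {V : Type} [Fintype V] {H : SimpleGraph V} {B : Finset V} {g W : V → ℕ}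
    {k : ℕ} {x : ℕ → V} (hk : 3 ≤ k) (hk5 : k ≠ 5) (hk7 : k ≠ 7)
    (inj : Set.InjOn x (Set.Icc 1 k)) (notB : ∀ i, 1 ≤ i → i ≤ k → x i ∉ B)
    (adj : ∀ i, 1 ≤ i → i < k → H.Adj (x i) (x (i + 1))) (adk : H.Adj (x k) (x 1))
    (hcl : ∀ i, 1 ≤ i → i ≤ k → ∀ w, H.Adj (x i) w → (∃ j, 1 ≤ j ∧ j ≤ k ∧ w = x j))
    (hW0 : ∀ i, 1 ≤ i → i ≤ k → W (x i) = 0) :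
    Piece H B g W ((Finset.Icc 1 k).image x) := by
  have hsum : ∑ i ∈ Finset.Icc 1 k, W (x i) = 0 :=
    Finset.sum_eq_zero (fun i hi => hW0 i (Finset.mem_Icc.1 hi).1 (Finset.mem_Icc.1 hi).2)
  have adl : ∀ i, 1 < i → i ≤ k → H.Adj (x i) (x (i - 1)) := by
    intro i h1 h2
    have := adj (i - 1) (by omega) (by omega)
    rw [show i - 1 + 1 = i by omega] at this
    exact this.symm
  by_cases h39 : k = 3 ∨ k = 9
  · refine seq_piece H B g W _ x inj notB (fun i h1 h2 w hw => Or.inl (hcl i h1 h2 w hw))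
        (fun i => if i % 3 = 1 then 3 else 0) ?_ ?_
    · intro f hf1 hf2 i h1 h2
      have fi := hf1 i h1 h2
      by_cases c : i % 3 = 1
      · rw [if_pos c] at fi
        exact ⟨by omega, fun h => by omega, fun h => by omega⟩
      · rw [if_neg c] at fi
        refine ⟨by omega, fun _ => Or.inr ?_, fun h => by omega⟩
        by_cases c2 : i % 3 = 2
        · exact ⟨_, adl i (by omega) h2, by rw [hf1 _ (by omega) (by omega), if_pos (by omega)]⟩
        · by_cases c3 : i = k
          · subst c3
            exact ⟨_, adk, by rw [hf1 _ le_rfl (by omega), if_pos (by omega)]⟩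
          · exact ⟨_, adj i h1 (by omega), by rw [hf1 _ (by omega) (by omega), if_pos (by omega)]⟩
    · rw [hsum]
      rcases h39 with rfl | rfl <;> decide
  · refine seq_piece H B g W _ x inj notB (fun i h1 h2 w hw => Or.inl (hcl i h1 h2 w hw))
        (fun i => if i % 2 = 1 then 2 else 0) ?_ ?_
    · intro f hf1 hf2 i h1 h2
      have fi := hf1 i h1 h2
      by_cases c : i % 2 = 1
      · rw [if_pos c] at fi
        exact ⟨by omega, fun h => by omega, fun h => by omega⟩
      · rw [if_neg c] at fi
        refine ⟨by omega, fun _ => Or.inl ?_, fun h => by omega⟩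
        have e1 : f (x (i - 1)) = 2 := by rw [hf1 _ (by omega) (by omega), if_pos (by omega)]
        by_cases c3 : i = k
        · subst c3
          refine ⟨x (i - 1), x 1, ?_, adl i (by omega) h2, adk, e1, ?_⟩
          · intro h
            have := inj ⟨by omega, by omega⟩ ⟨by omega, by omega⟩ h
            omega
          · rw [hf1 _ le_rfl (by omega), if_pos (by omega)]
        · refine ⟨x (i - 1), x (i + 1), ?_, adl i (by omega) h2, adj i h1 (by omega), e1, ?_⟩
          · intro h
            have := inj ⟨by omega, by omega⟩ ⟨by omega, by omega⟩ h
            omega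
          · rw [hf1 _ (by omega) (by omega), if_pos (by omega)]
    · rw [hsum]
      rcases Nat.even_or_odd' k with ⟨m, rfl | rfl⟩
      · rw [sum_alt']; omega
      · rw [Finset.sum_Icc_succ_top (by omega), sum_alt', if_pos (by omega)]
        omega

/-- If `y` has degree two then two distinct neighbours are all neighbours. -/
theorem two_nbrs {V : Type} [Fintype V] {H : SimpleGraph V} {y a b : V}
    (hd : (N H y).card = 2) (ha : H.Adj y a) (hb : H.Adj y b) (hab : a ≠ b) (w : V) :
    H.Adj y w ↔ w = a ∨ w = b := by
  classical
  have hsub : ({a, b} : Finset V) ⊆ N H y := by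
    intro z hz
    simp only [Finset.mem_insert, Finset.mem_singleton] at hz
    rcases hz with rfl | rfl
    · exact mem_N.2 ha
    · exact mem_N.2 hb
  have heq := Finset.eq_of_subset_of_card_le hsub (by rw [hd, Finset.card_pair hab])
  rw [← mem_N, ← heq]
  simp

theorem other_nbr {V : Type} [Fintype V] {H : SimpleGraph V} {y a : V}
    (hd : (N H y).card = 2) : ∃ w, w ≠ a ∧ H.Adj y w := by
  classical
  obtain ⟨w, hw, hne⟩ := Finset.exists_mem_ne (s := N H y) (by omega) a
  exact ⟨w, hne, mem_N.1 hw⟩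

/-- A path `x 1, …, x k` inside `S`. -/
structure PathIn {V : Type} (H : SimpleGraph V) (S : Finset V) (k : ℕ) (x : ℕ → V) : Prop where
  inj : Set.InjOn x (Set.Icc 1 k)
  mem : ∀ i, 1 ≤ i → i ≤ k → x i ∈ S
  adj : ∀ i, 1 ≤ i → i < k → H.Adj (x i) (x (i + 1))

theorem PathIn.rev {V : Type} {H : SimpleGraph V} {S : Finset V} {k : ℕ} {x : ℕ → V}
    (P : PathIn H S k x) : PathIn H S k (fun i => x (k + 1 - i)) where
  inj := by
    intro i hi j hj hij
    have := P.inj (x₁ := k + 1 - i) (x₂ := k + 1 - j)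
      ⟨by have := hi.2; omega, by have := hi.1; omega⟩
      ⟨by have := hj.2; omega, by have := hj.1; omega⟩ hij
    have := hi.2; have := hj.2
    omega
  mem := fun i h1 h2 => P.mem _ (by omega) (by omega)
  adj := by
    intro i h1 h2
    have := P.adj (k + 1 - (i + 1)) (by omega) (by omega)
    rw [show k + 1 - (i + 1) + 1 = k + 1 - i by omega] at this
    exact this.symm

theorem PathIn.le_card {V : Type} {H : SimpleGraph V} {S : Finset V} {k : ℕ} {x : ℕ → V}
    (P : PathIn H S k x) : k ≤ S.card := by
  classical
  have h : ((Finset.Icc 1 k).image x).card = k := by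
    rw [Finset.card_image_of_injOn (by simpa using P.inj)]
    simp
  rw [← h]
  refine Finset.card_le_card ?_
  intro y hy
  obtain ⟨i, hi, rfl⟩ := Finset.mem_image.1 hy
  rw [Finset.mem_Icc] at hi
  exact P.mem i hi.1 hi.2

theorem PathIn.snoc {V : Type} {H : SimpleGraph V} {S : Finset V} {k : ℕ} {x : ℕ → V}
    (P : PathIn H S k x) (hk : 1 ≤ k) (w : V) (hw : w ∈ S) (ha : H.Adj (x k) w)
    (hnew : ∀ i, 1 ≤ i → i ≤ k → x i ≠ w) :
    PathIn H S (k + 1) (fun i => if i = k + 1 then w else x i) where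
  inj := by
    intro i hi j hj hij
    have hi1 := hi.1
    have hi2 := hi.2
    have hj1 := hj.1
    have hj2 := hj.2
    beta_reduce at hij
    split_ifs at hij with h1 h2 h2
    · omega
    · exact absurd hij.symm (hnew j hj1 (by omega))
    · exact absurd hij (hnew i hi1 (by omega))
    · exact P.inj ⟨hi1, by omega⟩ ⟨hj1, by omega⟩ hij
  mem := by
    intro i h1 h2
    beta_reduce
    split_ifs with h
    · exact hw
    · exact P.mem i h1 (by omega)
  adj := by
    intro i h1 h2
    beta_reduce
    rw [if_neg (by omega)]
    split_ifs with h
    · obtain rfl : i = k := by omega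
      exact ha
    · exact P.adj i h1 (by omega)

theorem path_right {V : Type} [Fintype V] {H : SimpleGraph V} {S B : Finset V} {k : ℕ}
    {x : ℕ → V} (P : PathIn H S k x) (hk : 2 ≤ k) (hmax : ∀ y, ¬ PathIn H S (k + 1) y)
    (hcl : ∀ y ∈ S, ∀ w, H.Adj y w → w ∈ S ∨ w ∈ B) (hdeg : ∀ y ∈ S, (N H y).card = 2)
    {w : V} (ha : H.Adj (x k) w) (hne : w ≠ x (k - 1)) : w ∈ B ∨ (w = x 1 ∧ 3 ≤ k) := by
  rcases hcl _ (P.mem k (by omega) le_rfl) w ha with hw | hw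
  swap
  · exact Or.inl hw
  right
  by_cases hnew : ∀ i, 1 ≤ i → i ≤ k → x i ≠ w
  · exact absurd (P.snoc (by omega) w hw ha hnew) (hmax _)
  push Not at hnew
  obtain ⟨j, h1, h2, rfl⟩ := hnew
  have hjk : j ≠ k := by
    rintro rfl
    exact H.irrefl ha
  have hjk' : j ≠ k - 1 := by
    rintro rfl
    exact hne rfl
  by_cases hj : j = 1
  · subst hj
    exact ⟨rfl, by omega⟩
  exfalso
  have a1 : H.Adj (x j) (x (j - 1)) := by
    have := P.adj (j - 1) (by omega) (by omega)
    rw [show j - 1 + 1 = j by omega] at this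
    exact this.symm
  have a2 : H.Adj (x j) (x (j + 1)) := P.adj j h1 (by omega)
  have hne2 : x (j - 1) ≠ x (j + 1) := by
    intro h
    have := P.inj ⟨by omega, by omega⟩ ⟨by omega, by omega⟩ h
    omega
  rcases (two_nbrs (hdeg _ (P.mem j h1 h2)) a1 a2 hne2 (x k)).1 ha.symm with h | h
  · have := P.inj ⟨by omega, by omega⟩ ⟨by omega, by omega⟩ h
    omega
  · have := P.inj ⟨by omega, by omega⟩ ⟨by omega, by omega⟩ h
    omega

/-- A set of vertices of degree two contains a thread or a cycle. -/
theorem thread_or_cycle {V : Type} [Fintype V] {H : SimpleGraph V} {S B : Finset V}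
    (hne : S.Nonempty) (hSB : ∀ y ∈ S, y ∉ B)
    (hcl : ∀ y ∈ S, ∀ w, H.Adj y w → w ∈ S ∨ w ∈ B) (hdeg : ∀ y ∈ S, (N H y).card = 2) :
    ∃ k x, 1 ≤ k ∧ (∀ i, 1 ≤ i → i ≤ k → x i ∈ S) ∧ (Thread H B k x ∨
      (3 ≤ k ∧ PathIn H S k x ∧ H.Adj (x k) (x 1))) := by
  classical
  obtain ⟨y0, hy0⟩ := hne
  have hp1 : PathIn H S 1 (fun _ => y0) :=
    ⟨fun i hi j hj _ => by have := hi.1; have := hi.2; have := hj.1; have := hj.2; omega,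
      fun i _ _ => hy0, fun i h1 h2 => by omega⟩
  have hS1 : 1 ≤ S.card := hp1.le_card
  have hex : ∃ k, 1 ≤ k ∧ (∃ x, PathIn H S k x) ∧ ∀ y, ¬ PathIn H S (k + 1) y := by
    have h1 := Nat.findGreatest_spec (P := fun k => ∃ x, PathIn H S k x) hS1 ⟨_, hp1⟩
    refine ⟨Nat.findGreatest (fun k => ∃ x, PathIn H S k x) S.card, ?_, h1, ?_⟩
    · exact Nat.le_findGreatest hS1 ⟨_, hp1⟩
    · intro y hy
      have := Nat.le_findGreatest (P := fun k => ∃ x, PathIn H S k x) hy.le_card ⟨y, hy⟩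
      omega
  obtain ⟨k, hk, ⟨x, P⟩, hmax⟩ := hex
  by_cases hk1 : k = 1
  · subst hk1
    have hx := P.mem 1 le_rfl le_rfl
    have hB : ∀ w, H.Adj (x 1) w → w ∈ B := by
      intro w hw
      rcases hcl _ hx w hw with h | h
      · refine absurd (P.snoc le_rfl w h hw ?_) (hmax _)
        intro i h1 h2
        obtain rfl : i = 1 := by omega
        exact hw.ne
      · exact h
    obtain ⟨a, -, ha⟩ := other_nbr (a := x 1) (hdeg _ hx)
    obtain ⟨b, hb', hb⟩ := other_nbr (a := a) (hdeg _ hx)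
    refine ⟨1, fun i => if i = 0 then a else if i = 1 then x 1 else b, le_rfl, ?_, Or.inl ?_⟩
    · intro i h1 h2
      obtain rfl : i = 1 := by omega
      simpa using hx
    · refine ⟨?_, ?_, by simpa using hB a ha, by simpa using hB b hb, ?_, ?_⟩
      · intro i hi j hj _
        have := hi.1; have := hi.2; have := hj.1; have := hj.2; omega
      · intro i h1 h2
        obtain rfl : i = 1 := by omega
        simpa using hSB _ hx
      · intro i h1 h2 w
        obtain rfl : i = 1 := by omega
        simpa using two_nbrs (hdeg _ hx) ha hb hb'.symm w
      · intro i h1 h2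
        obtain rfl : i = 1 := by omega
        simpa using hb'.symm
  have hk2 : 2 ≤ k := by omega
  obtain ⟨b, hbne, hb⟩ := other_nbr (a := x (k - 1)) (hdeg _ (P.mem k hk le_rfl))
  obtain ⟨a, hane, ha⟩ := other_nbr (a := x 2) (hdeg _ (P.mem 1 le_rfl hk))
  have hbr := path_right P hk2 hmax hcl hdeg hb hbne
  have har := path_right P.rev hk2 hmax hcl hdeg (w := a)
    (by rw [show k + 1 - k = 1 by omega]; exact ha)
    (by rw [show k + 1 - (k - 1) = 2 by omega]; exact hane)
  rw [show k + 1 - 1 = k by omega] at har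
  by_cases hcyc : H.Adj (x k) (x 1) ∧ 3 ≤ k
  · exact ⟨k, x, hk, P.mem, Or.inr ⟨hcyc.2, P, hcyc.1⟩⟩
  have hbB : b ∈ B := by
    rcases hbr with h | ⟨rfl, h⟩
    · exact h
    · exact absurd ⟨hb, h⟩ hcyc
  have haB : a ∈ B := by
    rcases har with h | ⟨rfl, h⟩
    · exact h
    · exact absurd ⟨ha.symm, h⟩ hcyc
  refine ⟨k, fun i => if i = 0 then a else if i = k + 1 then b else x i, hk, ?_, Or.inl ?_⟩
  · intro i h1 h2
    beta_reduce
    rw [if_neg (by omega), if_neg (by omega)]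
    exact P.mem i h1 h2
  have hxa : ∀ i, 1 ≤ i → i ≤ k → x i ≠ a := by
    rintro i h1 h2 rfl
    exact hSB _ (P.mem i h1 h2) haB
  have hxb : ∀ i, 1 ≤ i → i ≤ k → x i ≠ b := by
    rintro i h1 h2 rfl
    exact hSB _ (P.mem i h1 h2) hbB
  have hmid : ∀ i, 1 ≤ i → i ≤ k →
      (if i - 1 = 0 then a else if i - 1 = k + 1 then b else x (i - 1)) ≠
      (if i + 1 = 0 then a else if i + 1 = k + 1 then b else x (i + 1)) ∧
      H.Adj (x i) (if i - 1 = 0 then a else if i - 1 = k + 1 then b else x (i - 1)) ∧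
      H.Adj (x i) (if i + 1 = 0 then a else if i + 1 = k + 1 then b else x (i + 1)) := by
    intro i h1 h2
    rw [if_neg (show ¬ i + 1 = 0 by omega), if_neg (show ¬ i - 1 = k + 1 by omega)]
    have hl : i - 1 ≠ 0 → H.Adj (x i) (x (i - 1)) := by
      intro h
      have := P.adj (i - 1) (by omega) (by omega)
      rw [show i - 1 + 1 = i by omega] at this
      exact this.symm
    by_cases c1 : i - 1 = 0
    · obtain rfl : i = 1 := by omega
      rw [if_pos c1, if_neg (by omega)]
      exact ⟨(hxa 2 (by omega) (by omega)).symm, ha, P.adj 1 le_rfl (by omega)⟩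
    · rw [if_neg c1]
      by_cases c2 : i + 1 = k + 1
      · rw [if_pos c2]
        obtain rfl : i = k := by omega
        exact ⟨hxb _ (by omega) (by omega), hl c1, hb⟩
      · rw [if_neg c2]
        refine ⟨?_, hl c1, P.adj i h1 (by omega)⟩
        intro h
        have := P.inj ⟨by omega, by omega⟩ ⟨by omega, by omega⟩ h
        omega
  refine ⟨?_, ?_, by simpa using haB, by simpa using hbB, ?_, ?_⟩
  · intro i hi j hj hij
    have hi1 := hi.1
    have hi2 := hi.2
    have hj1 := hj.1
    have hj2 := hj.2
    beta_reduce at hij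
    rw [if_neg (by omega), if_neg (by omega), if_neg (by omega), if_neg (by omega)] at hij
    exact P.inj hi hj hij
  · intro i h1 h2
    beta_reduce
    rw [if_neg (by omega), if_neg (by omega)]
    exact hSB _ (P.mem i h1 h2)
  · intro i h1 h2 w
    beta_reduce
    rw [if_neg (show ¬ i = 0 by omega), if_neg (show ¬ i = k + 1 by omega)]
    obtain ⟨m1, m2, m3⟩ := hmid i h1 h2
    exact two_nbrs (hdeg _ (P.mem i h1 h2)) m2 m3 m1 w
  · intro i h1 h2
    exact (hmid i h1 h2).1

open Classical in
theorem account {V : Type} [Fintype V] {H : SimpleGraph V} {B : Finset V} {g W : V → ℕ}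
    {h : V → V → ℕ} (hW : ∀ y, W y = ∑ v ∈ (N H y).filter (· ∈ B), h v y)
    (hind : ∀ a ∈ B, ∀ b ∈ B, ¬ H.Adj a b) (hP : Piece H B g W (Finset.univ \ B))
    (hg : ∀ v ∈ B, g v = 2 ∨ g v = 3) (hv : ∀ v ∈ B, 20 * g v ≤ 22 + ∑ y ∈ N H v, h v y) :
    ∃ f : V → ℕ, (∀ y, Good H f y) ∧ 20 * ∑ y, f y ≤ 22 * Fintype.card V := by
  obtain ⟨-, -, f, hf1, hf2, hf3⟩ := hP
  refine ⟨f, ?_, ?_⟩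
  · intro y
    by_cases hy : y ∈ B
    · have := hf1 y hy
      have := hg y hy
      exact ⟨by omega, fun h => by omega, fun h => by omega⟩
    · exact hf2 y (by simp [hy])
  · have e1 : ∑ y, f y = ∑ y ∈ Finset.univ \ B, f y + ∑ y ∈ B, f y :=
      (Finset.sum_sdiff (Finset.subset_univ B)).symm
    have e2 : Fintype.card V = (Finset.univ \ B).card + B.card := by
      rw [Finset.card_sdiff_of_subset (Finset.subset_univ B), Finset.card_univ]
      have := Finset.card_le_univ B
      omega
    have e3 : ∑ y ∈ Finset.univ \ B, W y = ∑ v ∈ B, ∑ y ∈ N H v, h v y := by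
      simp only [hW]
      refine Finset.sum_comm' ?_
      intro y v
      simp only [Finset.mem_sdiff, Finset.mem_univ, true_and, Finset.mem_filter, mem_N]
      constructor
      · rintro ⟨_, h2, h3⟩
        exact ⟨h2.symm, h3⟩
      · rintro ⟨h2, h3⟩
        exact ⟨fun hy => hind v h3 y hy h2, h2.symm, h3⟩
    have e4 : ∑ y ∈ B, f y = ∑ y ∈ B, g y := Finset.sum_congr rfl hf1
    have e5 : 20 * ∑ v ∈ B, g v ≤ 22 * B.card + ∑ v ∈ B, ∑ y ∈ N H v, h v y := by
      rw [Finset.mul_sum]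
      refine (Finset.sum_le_sum hv).trans ?_
      rw [Finset.sum_add_distrib]
      simp [mul_comm]
    rw [e1, e2, e4]
    omega

open Classical in
/-- Finite families with a labelling pattern are pieces. -/
theorem fin_piece {V : Type} [Fintype V] (H : SimpleGraph V) (B : Finset V) (g W : V → ℕ)
    (n : ℕ) (x : Fin n → V) (hinj : Function.Injective x)
    (hB : ∀ i, x i ∉ B)
    (hcl : ∀ i w, H.Adj (x i) w → (∃ j, w = x j) ∨ w ∈ B)
    (p : Fin n → ℕ)
    (hgood : ∀ f : V → ℕ, (∀ i, f (x i) = p i) → (∀ v ∈ B, f v = g v) → ∀ i, Good H f (x i))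
    (hcost : 20 * ∑ i, p i + ∑ i, W (x i) ≤ 22 * n) :
    Piece H B g W (Finset.univ.image x) := by
  have hf1 : ∀ i, Function.extend x p g (x i) = p i := fun i => hinj.extend_apply p g i
  have hf2 : ∀ v ∈ B, Function.extend x p g v = g v := by
    intro v hv
    refine Function.extend_apply' _ _ _ ?_
    rintro ⟨i, rfl⟩
    exact hB i hv
  refine ⟨?_, ?_, Function.extend x p g, hf2, ?_, ?_⟩
  · intro y hy w hw
    obtain ⟨i, -, rfl⟩ := Finset.mem_image.1 hy
    rcases hcl i w hw with ⟨j, rfl⟩ | h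
    · exact Or.inl (Finset.mem_image.2 ⟨j, Finset.mem_univ _, rfl⟩)
    · exact Or.inr h
  · intro y hy
    obtain ⟨i, -, rfl⟩ := Finset.mem_image.1 hy
    exact hB i
  · intro y hy
    obtain ⟨i, -, rfl⟩ := Finset.mem_image.1 hy
    exact hgood _ hf1 hf2 i
  · rw [Finset.sum_image hinj.injOn, Finset.sum_image hinj.injOn,
      Finset.card_image_of_injective _ hinj]
    simp only [hf1]
    simpa using hcost

/-- `x` enumerates a component of `H` that is a cycle. -/
def Cyc {V : Type} (H : SimpleGraph V) (n : ℕ) [NeZero n] (x : Fin n → V) : Prop :=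
  Function.Injective x ∧ ∀ i w, H.Adj (x i) w ↔ w = x (i + 1) ∨ w = x (i - 1)

/-- `x` enumerates a cycle, to which a single extra edge from `x 0` to `v` is attached. -/
structure Att {V : Type} (H : SimpleGraph V) (n : ℕ) [NeZero n] (x : Fin n → V) (v : V) :
    Prop where
  inj : Function.Injective x
  adj : ∀ i, H.Adj (x i) (x (i + 1))
  ext : H.Adj (x 0) v
  ne1 : v ≠ x 1
  ne2 : v ≠ x (-1)
  nbr : ∀ i w, H.Adj (x i) w →
    w = x (i + 1) ∨ w = x (i - 1) ∨ (i = 0 ∧ w = v) ∨ (x i = v ∧ w = x 0)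

/-- The pattern `p` is good at `i` for the edge relation `E`. -/
def PatOK {n : ℕ} (E : Fin n → Fin n → Prop) (p : Fin n → ℕ) (i : Fin n) : Prop :=
  p i ≤ 3 ∧ (p i = 0 → (∃ a b, a ≠ b ∧ E i a ∧ E i b ∧ p a = 2 ∧ p b = 2) ∨
    ∃ a, E i a ∧ p a = 3) ∧ (p i = 1 → ∃ a, E i a ∧ 2 ≤ p a)

theorem PatOK.good {V : Type} {H : SimpleGraph V} {n : ℕ} {E : Fin n → Fin n → Prop}
    {p : Fin n → ℕ} {i : Fin n} (hp : PatOK E p i) {x : Fin n → V} (hinj : Function.Injective x)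
    (hE : ∀ i j, E i j → H.Adj (x i) (x j)) {f : V → ℕ} (hf : ∀ i, f (x i) = p i) :
    Good H f (x i) := by
  obtain ⟨h1, h2, h3⟩ := hp
  refine ⟨by rw [hf]; exact h1, ?_, ?_⟩
  · intro h
    rw [hf] at h
    rcases h2 h with ⟨a, b, hab, ha, hb, pa, pb⟩ | ⟨a, ha, pa⟩
    · exact Or.inl ⟨x a, x b, hinj.ne hab, hE _ _ ha, hE _ _ hb, by rw [hf, pa], by rw [hf, pb]⟩
    · exact Or.inr ⟨x a, hE _ _ ha, by rw [hf, pa]⟩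
  · intro h
    rw [hf] at h
    obtain ⟨a, ha, pa⟩ := h3 h
    exact ⟨x a, hE _ _ ha, by rw [hf]; exact pa⟩

/-- Edges of the cycle with a chord from `0` to `j`. -/
def EC (n : ℕ) [NeZero n] (j : Fin n) (i a : Fin n) : Prop :=
  a = i + 1 ∨ i = a + 1 ∨ (i = 0 ∧ a = j) ∨ (a = 0 ∧ i = j)

/-- Edges of the cycle. -/
def EP (n : ℕ) [NeZero n] (i a : Fin n) : Prop := a = i + 1 ∨ i = a + 1

instance (n : ℕ) [NeZero n] (j i a : Fin n) : Decidable (EC n j i a) := by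
  unfold EC; infer_instance

instance (n : ℕ) [NeZero n] (i a : Fin n) : Decidable (EP n i a) := by
  unfold EP; infer_instance

instance {n : ℕ} (E : Fin n → Fin n → Prop) [∀ i a, Decidable (E i a)] (p : Fin n → ℕ)
    (i : Fin n) : Decidable (PatOK E p i) := by
  unfold PatOK; infer_instance

theorem chord_pat5 : ∀ j : Fin 5, j ≠ 0 → j ≠ 1 → j ≠ -1 →
    ∃ p : Fin 5 → ℕ, (∀ i, PatOK (EC 5 j) p i) ∧ ∑ i, p i ≤ 5 := by
  intro j h0 h1 h2
  have : j = 2 ∨ j = 3 := by revert j; decide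
  rcases this with rfl | rfl
  · exact ⟨![3, 0, 0, 2, 0], by decide, by decide⟩
  · exact ⟨![3, 0, 2, 0, 0], by decide, by decide⟩

theorem chord_pat7 : ∀ j : Fin 7, j ≠ 0 → j ≠ 1 → j ≠ -1 →
    ∃ p : Fin 7 → ℕ, (∀ i, PatOK (EC 7 j) p i) ∧ ∑ i, p i ≤ 7 := by
  intro j h0 h1 h2
  have : j = 2 ∨ j = 3 ∨ j = 4 ∨ j = 5 := by revert j; decide
  rcases this with rfl | rfl | rfl | rfl
  · exact ⟨![3, 0, 0, 0, 3, 0, 0], by decide, by decide⟩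
  · exact ⟨![2, 0, 2, 0, 1, 2, 0], by decide, by decide⟩
  · exact ⟨![2, 0, 2, 1, 0, 2, 0], by decide, by decide⟩
  · exact ⟨![3, 0, 0, 3, 0, 0, 0], by decide, by decide⟩

theorem Att.nbr_range {V : Type} {H : SimpleGraph V} {n : ℕ} [NeZero n] {x : Fin n → V} {v : V}
    (A : Att H n x v) (hv : v ∈ Set.range x) (i : Fin n) (w : V) (hw : H.Adj (x i) w) :
    ∃ j, w = x j := by
  rcases A.nbr i w hw with h | h | ⟨-, h⟩ | ⟨-, h⟩
  · exact ⟨_, h⟩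
  · exact ⟨_, h⟩
  · obtain ⟨j, rfl⟩ := hv
    exact ⟨j, h⟩
  · exact ⟨_, h⟩

open Classical in
theorem chord_piece {V : Type} [Fintype V] {H : SimpleGraph V} {B : Finset V} {g W : V → ℕ}
    {n : ℕ} [NeZero n]
    (hpat : ∀ j : Fin n, j ≠ 0 → j ≠ 1 → j ≠ -1 →
      ∃ p : Fin n → ℕ, (∀ i, PatOK (EC n j) p i) ∧ ∑ i, p i ≤ n)
    {x : Fin n → V} {v : V} (A : Att H n x v) (hv : v ∈ Set.range x)
    (hB : ∀ i, x i ∉ B) (hW : ∀ i, W (x i) = 0) : Piece H B g W (Finset.univ.image x) := by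
  obtain ⟨j, rfl⟩ := hv
  obtain ⟨p, hp1, hp2⟩ := hpat j (fun h => A.ext.ne (by rw [h])) (fun h => A.ne1 (by rw [h]))
    (fun h => A.ne2 (by rw [h]))
  refine fin_piece H B g W n x A.inj hB
    (fun i w hw => Or.inl (A.nbr_range ⟨j, rfl⟩ i w hw)) p ?_ ?_
  · intro f hf _ i
    refine (hp1 i).good A.inj ?_ hf
    rintro i a (rfl | rfl | ⟨rfl, rfl⟩ | ⟨rfl, rfl⟩)
    · exact A.adj i
    · exact (A.adj a).symm
    · exact A.ext
    · exact A.ext.symm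
  · simp only [hW]
    simp
    omega

open Classical in
theorem pend_piece5 {V : Type} [Fintype V] {H : SimpleGraph V} {B : Finset V} {g W : V → ℕ}
    {x : Fin 5 → V} {v : V} (A : Att H 5 x v) (hv : v ∉ Set.range x)
    (hB : ∀ i, x i ∉ B) (hvB : v ∈ B) (hg : g v = 2 ∨ g v = 3)
    (hW : ∀ i, i ≠ 0 → W (x i) = 0) (hW0 : W (x 0) ≤ 10) :
    Piece H B g W (Finset.univ.image x) := by
  refine fin_piece H B g W 5 x A.inj hB ?_ ![0, 2, 0, 3, 0] ?_ ?_
  · intro i w hw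
    rcases A.nbr i w hw with h | h | ⟨-, rfl⟩ | ⟨-, h⟩
    · exact Or.inl ⟨_, h⟩
    · exact Or.inl ⟨_, h⟩
    · exact Or.inr hvB
    · exact Or.inl ⟨_, h⟩
  · intro f hf hfB i
    by_cases hi : i = 0
    · subst hi
      have f0 : f (x 0) = 0 := hf 0
      have f1 : f (x 1) = 2 := hf 1
      have fv := hfB v hvB
      refine ⟨by omega, fun _ => ?_, fun h => by omega⟩
      rcases hg with h | h
      · exact Or.inl ⟨v, x 1, A.ne1, A.ext, A.adj 0, by omega, f1⟩
      · exact Or.inr ⟨v, A.ext, by omega⟩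
    · have : ∀ i : Fin 5, i ≠ 0 → PatOK (EP 5) ![0, 2, 0, 3, 0] i := by decide
      refine (this i hi).good A.inj ?_ hf
      rintro i a (rfl | rfl)
      · exact A.adj i
      · exact (A.adj a).symm
  · rw [Finset.sum_eq_single (0 : Fin 5) (f := fun i => W (x i)) (fun i _ hi => hW i hi)
      (by simp)]
    simp [Fin.sum_univ_five]
    omega

open Classical in
theorem pend_piece7 {V : Type} [Fintype V] {H : SimpleGraph V} {B : Finset V} {g W : V → ℕ}
    {x : Fin 7 → V} {v : V} (A : Att H 7 x v) (hv : v ∉ Set.range x)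
    (hB : ∀ i, x i ∉ B) (hvB : v ∈ B) (hg : g v = 3)
    (hW : ∀ i, i ≠ 0 → W (x i) = 0) (hW0 : W (x 0) ≤ 18) :
    Piece H B g W (Finset.univ.image x) := by
  refine fin_piece H B g W 7 x A.inj hB ?_ ![0, 0, 3, 0, 0, 3, 0] ?_ ?_
  · intro i w hw
    rcases A.nbr i w hw with h | h | ⟨-, rfl⟩ | ⟨-, h⟩
    · exact Or.inl ⟨_, h⟩
    · exact Or.inl ⟨_, h⟩
    · exact Or.inr hvB
    · exact Or.inl ⟨_, h⟩
  · intro f hf hfB i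
    by_cases hi : i = 0
    · subst hi
      have f0 : f (x 0) = 0 := hf 0
      have fv := hfB v hvB
      exact ⟨by omega, fun _ => Or.inr ⟨v, A.ext, by omega⟩, fun h => by omega⟩
    · have : ∀ i : Fin 7, i ≠ 0 → PatOK (EP 7) ![0, 0, 3, 0, 0, 3, 0] i := by decide
      refine (this i hi).good A.inj ?_ hf
      rintro i a (rfl | rfl)
      · exact A.adj i
      · exact (A.adj a).symm
  · rw [Finset.sum_eq_single (0 : Fin 7) (f := fun i => W (x i)) (fun i _ hi => hW i hi)
      (by simp)]
    simp [Fin.sum_univ_seven]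
    omega

theorem Att.deg_le {V : Type} [Fintype V] {H : SimpleGraph V} {n : ℕ} [NeZero n]
    {x : Fin n → V} {v : V} (A : Att H n x v) (hv : v ∉ Set.range x) (i : Fin n) (hi : i ≠ 0) :
    (N H (x i)).card ≤ 2 := by
  classical
  have : N H (x i) ⊆ {x (i + 1), x (i - 1)} := by
    intro w hw
    rcases A.nbr i w (mem_N.1 hw) with h | h | ⟨h, -⟩ | ⟨h, -⟩
    · simp [h]
    · simp [h]
    · exact absurd h hi
    · exact absurd ⟨i, h⟩ hv
  exact (Finset.card_le_card this).trans Finset.card_le_two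

theorem Att.three_le {V : Type} [Fintype V] {H : SimpleGraph V} {n : ℕ} [NeZero n]
    {x : Fin n → V} {v : V} (A : Att H n x v) (h1 : (1 : Fin n) ≠ -1) :
    3 ≤ (N H (x 0)).card := by
  classical
  have : ({v, x 1, x (-1)} : Finset V) ⊆ N H (x 0) := by
    intro w hw
    simp only [Finset.mem_insert, Finset.mem_singleton] at hw
    rcases hw with rfl | rfl | rfl
    · exact mem_N.2 A.ext
    · have := A.adj 0
      rw [zero_add] at this
      exact mem_N.2 this
    · have := A.adj (-1)
      rw [neg_add_cancel] at this
      exact mem_N.2 this.symm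
  have h := Finset.card_le_card this
  rwa [Finset.card_eq_three.2 ⟨v, x 1, x (-1), A.ne1, A.ne2, A.inj.ne h1, rfl⟩] at h

theorem Att.uniq {V : Type} [Fintype V] {H : SimpleGraph V} {n : ℕ} [NeZero n]
    {x : Fin n → V} {v : V} (A : Att H n x v) (hv : v ∉ Set.range x) (h1 : (1 : Fin n) ≠ 0)
    (w : V) (hw : H.Adj (x 0) w) (hd : 3 ≤ (N H w).card) : w = v := by
  rcases A.nbr 0 w hw with h | h | ⟨-, h⟩ | ⟨h, -⟩
  · have := A.deg_le hv (0 + 1) (by rwa [zero_add])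
    rw [← h] at this
    omega
  · have := A.deg_le hv (0 - 1) (by rw [zero_sub]; exact neg_ne_zero.2 h1)
    rw [← h] at this
    omega
  · exact h
  · exact absurd ⟨0, h⟩ hv

/-- Going around the cycle. -/
theorem around {V : Type} {n : ℕ} [NeZero n] {x : Fin n → V} {S : Set V}
    (hr : ∀ a : Fin n, a.val • (1 : Fin n) = a) (hstep : ∀ i, x i ∈ S → x (i + 1) ∈ S) (i : Fin n) (hi : x i ∈ S) (j : Fin n) : x j ∈ S := by
  have h : ∀ m : ℕ, x (i + m • (1 : Fin n)) ∈ S := by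
    intro m
    induction m with
    | zero => simpa using hi
    | succ m ih =>
      have := hstep _ ih
      rwa [succ_nsmul, ← add_assoc]
  have h2 := h (j - i).val
  rw [hr] at h2
  simpa using h2

theorem hr5 : ∀ a : Fin 5, a.val • (1 : Fin 5) = a := by decide
theorem hr7 : ∀ a : Fin 7, a.val • (1 : Fin 7) = a := by decide

/-- A cyclic path of vertices of degree two is a cycle component. -/
theorem cyc_of_path {V : Type} [Fintype V] {H : SimpleGraph V} {S : Finset V} {n : ℕ} [NeZero n]
    (hn : 3 ≤ n) {x : ℕ → V} (P : PathIn H S n x) (ha : H.Adj (x n) (x 1))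
    (hdeg : ∀ y ∈ S, (N H y).card = 2) (hpm : ∀ i : Fin n, i + 1 ≠ i - 1) :
    Cyc H n (fun i : Fin n => x (i.val + 1)) := by
  have hinj : Function.Injective (fun i : Fin n => x (i.val + 1)) := by
    intro i j hij
    have := P.inj (x₁ := i.val + 1) (x₂ := j.val + 1) ⟨by omega, by omega⟩
      ⟨by omega, by omega⟩ hij
    exact Fin.ext (by omega)
  have hadj : ∀ i : Fin n, H.Adj (x (i.val + 1)) (x ((i + 1).val + 1)) := by
    intro i
    have hv : (i + 1).val = (i.val + 1) % n := by
      rw [Fin.val_add, Fin.val_one', Nat.add_mod_mod]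
    rw [hv]
    by_cases h : i.val + 1 = n
    · rw [h, Nat.mod_self, zero_add]
      exact ha
    · rw [Nat.mod_eq_of_lt (by omega)]
      exact P.adj _ (by omega) (by omega)
  refine ⟨hinj, fun i w => ?_⟩
  have h2 := hadj (i - 1)
  rw [sub_add_cancel] at h2
  exact two_nbrs (hdeg _ (P.mem _ (by omega) (by omega))) (hadj i) h2.symm
    (hinj.ne (hpm i)) w

/-- The vertex `u` is the attachment vertex of a pendant `n`-cycle. -/
def Head {V : Type} [Fintype V] (H : SimpleGraph V) (n : ℕ) [NeZero n] (u : V) : Prop :=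
  ∃ (x : Fin n → V) (v : V), x 0 = u ∧ Att H n x v ∧ v ∉ Set.range x ∧ 3 ≤ (N H v).card

/-- The vertex `y` lies in a component consisting of an `n`-cycle with a chord. -/
def CV {V : Type} (H : SimpleGraph V) (n : ℕ) [NeZero n] (y : V) : Prop :=
  ∃ (x : Fin n → V) (v : V), Att H n x v ∧ v ∈ Set.range x ∧ y ∈ Set.range x

theorem CV.adj {V : Type} {H : SimpleGraph V} {n : ℕ} [NeZero n] {y w : V} (h : CV H n y)
    (hw : H.Adj y w) : CV H n w := by
  obtain ⟨x, v, A, hv, ⟨i, rfl⟩⟩ := h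
  obtain ⟨j, rfl⟩ := A.nbr_range hv i w hw
  exact ⟨x, v, A, hv, ⟨j, rfl⟩⟩

theorem Head.three_le {V : Type} [Fintype V] {H : SimpleGraph V} {n : ℕ} [NeZero n] {u : V}
    (h : Head H n u) (h1 : (1 : Fin n) ≠ -1) : 3 ≤ (N H u).card := by
  obtain ⟨x, v, rfl, A, -, -⟩ := h
  exact A.three_le h1

theorem Head.uniq {V : Type} [Fintype V] {H : SimpleGraph V} {n : ℕ} [NeZero n] {u : V}
    (h : Head H n u) (h1 : (1 : Fin n) ≠ 0) {a b : V} (ha : H.Adj u a) (hb : H.Adj u b)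
    (da : 3 ≤ (N H a).card) (db : 3 ≤ (N H b).card) : a = b := by
  obtain ⟨x, v, rfl, A, hv, -⟩ := h
  rw [A.uniq hv h1 a ha da, A.uniq hv h1 b hb db]

/-- Every edge joining two vertices of degree at least three carries a 5- or 7-cycle. -/
def EdgeMin {V : Type} [Fintype V] (H : SimpleGraph V) : Prop :=
  ∀ u v, H.Adj u v → 3 ≤ (N H u).card → 3 ≤ (N H v).card →
    (∃ x : Fin 5 → V, (x 0 = u ∧ Att H 5 x v) ∨ (x 0 = v ∧ Att H 5 x u)) ∨
    (∃ x : Fin 7 → V, (x 0 = u ∧ Att H 7 x v) ∨ (x 0 = v ∧ Att H 7 x u))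

/-- The choice of the pendant cycles. -/
theorem exists_choice {V : Type} [Fintype V] (H : SimpleGraph V) (hmin : EdgeMin H) :
    ∃ (P : V → Prop) (B : Finset V),
      (∀ v, v ∈ B ↔ 3 ≤ (N H v).card ∧ ¬ (CV H 5 v ∨ CV H 7 v) ∧ ¬ P v) ∧
      (∀ a ∈ B, ∀ b ∈ B, ¬ H.Adj a b) ∧
      (∀ u, P u → (Head H 5 u ∨ Head H 7 u) ∧ ¬ (CV H 5 u ∨ CV H 7 u)) ∧
      (∀ u v, P u → P v → ¬ H.Adj u v) := by
  classical
  let e := Fintype.equivFin V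
  let Hd : V → Prop := fun u => Head H 5 u ∨ Head H 7 u
  have Hd3 : ∀ u, Hd u → 3 ≤ (N H u).card := by
    rintro u (h | h)
    · exact h.three_le (by decide)
    · exact h.three_le (by decide)
  have Hdu : ∀ u, Hd u → ∀ a b, H.Adj u a → H.Adj u b → 3 ≤ (N H a).card →
      3 ≤ (N H b).card → a = b := by
    rintro u (h | h) a b ha hb da db
    · exact h.uniq (by decide) ha hb da db
    · exact h.uniq (by decide) ha hb da db
  let P : V → Prop := fun u => Hd u ∧ ¬ (CV H 5 u ∨ CV H 7 u) ∧
    ∀ u', Hd u' → H.Adj u u' → e u < e u'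
  have hB : ∀ v, v ∈ Finset.univ.filter
      (fun v => 3 ≤ (N H v).card ∧ ¬ (CV H 5 v ∨ CV H 7 v) ∧ ¬ P v) ↔
      3 ≤ (N H v).card ∧ ¬ (CV H 5 v ∨ CV H 7 v) ∧ ¬ P v := by
    intro v
    simp only [Finset.mem_filter, Finset.mem_univ, true_and]
  refine ⟨P, Finset.univ.filter
    (fun v => 3 ≤ (N H v).card ∧ ¬ (CV H 5 v ∨ CV H 7 v) ∧ ¬ P v), hB, ?_, ?_, ?_⟩
  · intro a ha b hb hab
    rw [hB] at ha hb
    -- a head cannot be in B together with its outer neighbour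
    have key : ∀ a b, H.Adj a b → Hd a → 3 ≤ (N H a).card → 3 ≤ (N H b).card →
        ¬ (CV H 5 a ∨ CV H 7 a) → ¬ (CV H 5 b ∨ CV H 7 b) → ¬ P a → ¬ P b → False := by
      intro a b hab ha da db ca cb pa pb
      have : ∃ u', Hd u' ∧ H.Adj a u' ∧ ¬ e a < e u' := by
        by_contra hcon
        push Not at hcon
        exact pa ⟨ha, ca, fun u' h1 h2 => hcon u' h1 h2⟩
      obtain ⟨u', h1, h2, h3⟩ := this
      obtain rfl : u' = b := Hdu a ha u' b h2 hab (Hd3 _ h1) db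
      refine pb ⟨h1, cb, ?_⟩
      intro u'' k1 k2
      obtain rfl : u'' = a := Hdu u' h1 u'' a k2 h2.symm (Hd3 _ k1) da
      refine lt_of_le_of_ne (not_lt.1 h3) ?_
      intro h
      exact h2.ne (e.injective h).symm
    rcases hmin a b hab ha.1 hb.1 with ⟨x, ⟨rfl, A⟩ | ⟨rfl, A⟩⟩ | ⟨x, ⟨rfl, A⟩ | ⟨rfl, A⟩⟩
    · by_cases h : b ∈ Set.range x
      · exact ha.2.1 (Or.inl ⟨x, b, A, h, ⟨0, rfl⟩⟩)
      · exact key _ b hab (Or.inl ⟨x, b, rfl, A, h, hb.1⟩) ha.1 hb.1 ha.2.1 hb.2.1 ha.2.2 hb.2.2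
    · by_cases h : a ∈ Set.range x
      · exact hb.2.1 (Or.inl ⟨x, a, A, h, ⟨0, rfl⟩⟩)
      · exact key _ a hab.symm (Or.inl ⟨x, a, rfl, A, h, ha.1⟩) hb.1 ha.1 hb.2.1 ha.2.1
          hb.2.2 ha.2.2
    · by_cases h : b ∈ Set.range x
      · exact ha.2.1 (Or.inr ⟨x, b, A, h, ⟨0, rfl⟩⟩)
      · exact key _ b hab (Or.inr ⟨x, b, rfl, A, h, hb.1⟩) ha.1 hb.1 ha.2.1 hb.2.1 ha.2.2 hb.2.2
    · by_cases h : a ∈ Set.range x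
      · exact hb.2.1 (Or.inr ⟨x, a, A, h, ⟨0, rfl⟩⟩)
      · exact key _ a hab.symm (Or.inr ⟨x, a, rfl, A, h, ha.1⟩) hb.1 ha.1 hb.2.1 ha.2.1
          hb.2.2 ha.2.2
  · exact fun u hu => ⟨hu.1, hu.2.1⟩
  · intro u v hu hv huv
    have h1 := hu.2.2 v hv.1 huv
    have h2 := hv.2.2 u hu.1 huv.symm
    exact lt_asymm h1 h2

/-- All neighbours are in `B` (threads with a single inner vertex). -/
def K1 {V : Type} (H : SimpleGraph V) (B : Finset V) (y : V) : Prop := ∀ w, H.Adj y w → w ∈ B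

/-- `y` is in a thread with two inner vertices. -/
def T2 {V : Type} (H : SimpleGraph V) (B : Finset V) (y : V) : Prop :=
  ∃ y', H.Adj y y' ∧ y' ∉ B ∧ (∀ w, H.Adj y w → w ≠ y' → w ∈ B) ∧
    (∀ w, H.Adj y' w → w ≠ y → w ∈ B)

open Classical in
/-- The label of the branch vertices. -/
noncomputable def lab {V : Type} [Fintype V] (H : SimpleGraph V) (B : Finset V) (P : V → Prop)
    (v : V) : ℕ :=
  if (N H v).card = 3 ∧ (∃ y, H.Adj v y ∧ (P y ∨ K1 H B y)) ∧
    (∀ y, H.Adj v y → ¬ (P y ∧ Head H 7 y) ∧ ¬ (¬ P y ∧ ¬ K1 H B y ∧ T2 H B y)) then 2 else 3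

open Classical in
/-- The charge sent to the branch vertex `v` by its neighbour `y`. -/
noncomputable def chg {V : Type} [Fintype V] (H : SimpleGraph V) (B : Finset V) (P : V → Prop)
    (v y : V) : ℕ :=
  if P y then (if Head H 7 y then 18 else 10)
  else if K1 H B y then 10
  else if T2 H B y then 22
  else if lab H B P v = 3 then 13 else 4

theorem lab_or {V : Type} [Fintype V] (H : SimpleGraph V) (B : Finset V) (P : V → Prop)
    (v : V) : lab H B P v = 2 ∨ lab H B P v = 3 := by
  unfold lab
  split_ifs
  · exact Or.inl rfl
  · exact Or.inr rfl

theorem chg_ge_four {V : Type} [Fintype V] (H : SimpleGraph V) (B : Finset V) (P : V → Prop)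
    (v y : V) : 4 ≤ chg H B P v y := by
  unfold chg
  split_ifs <;> omega

theorem chg_ge_ten {V : Type} [Fintype V] (H : SimpleGraph V) (B : Finset V) (P : V → Prop)
    (v y : V) (h : lab H B P v = 3) : 10 ≤ chg H B P v y := by
  unfold chg
  rw [if_pos h]
  split_ifs <;> omega

/-- A lower bound for a sum with one distinguished element. -/
theorem sum_ge {V : Type} (s : Finset V) (w : V → ℕ) (a b : ℕ) (y : V) (hy : y ∈ s)
    (hb : b ≤ w y) (ha : ∀ z ∈ s, a ≤ w z) : b + (s.card - 1) * a ≤ ∑ z ∈ s, w z := by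
  classical
  rw [← Finset.add_sum_erase s w hy]
  have this : (s.erase y).card • a ≤ ∑ z ∈ s.erase y, w z :=
    Finset.card_nsmul_le_sum (s.erase y) w a (fun z hz => ha z (Finset.mem_of_mem_erase hz))
  rw [Finset.card_erase_of_mem hy, smul_eq_mul] at this
  omega

theorem lab_le {V : Type} [Fintype V] (H : SimpleGraph V) (B : Finset V) (P : V → Prop)
    (v : V) (hd : 3 ≤ (N H v).card) :
    20 * lab H B P v ≤ 22 + ∑ y ∈ N H v, chg H B P v y := by
  classical
  by_cases hl : (N H v).card = 3 ∧ (∃ y, H.Adj v y ∧ (P y ∨ K1 H B y)) ∧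
    (∀ y, H.Adj v y → ¬ (P y ∧ Head H 7 y) ∧ ¬ (¬ P y ∧ ¬ K1 H B y ∧ T2 H B y))
  · have e : lab H B P v = 2 := by unfold lab; rw [if_pos hl]
    obtain ⟨h3, ⟨y, hy, hPK⟩, -⟩ := hl
    have hb : 10 ≤ chg H B P v y := by
      unfold chg
      by_cases h : P y
      · rw [if_pos h]; split_ifs <;> omega
      · rw [if_neg h, if_pos (by tauto)]
    have := sum_ge (N H v) (chg H B P v) 4 10 y (mem_N.2 hy) hb (fun z _ => chg_ge_four H B P v z)
    rw [h3] at this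
    omega
  · have e : lab H B P v = 3 := by unfold lab; rw [if_neg hl]
    have h10 : ∀ z ∈ N H v, 10 ≤ chg H B P v z := fun z _ => chg_ge_ten H B P v z e
    by_cases h3 : (N H v).card = 3
    · by_cases hall : ∀ y, H.Adj v y → ¬ (P y ∧ Head H 7 y) ∧ ¬ (¬ P y ∧ ¬ K1 H B y ∧ T2 H B y)
      · have hno : ∀ y, H.Adj v y → ¬ P y ∧ ¬ K1 H B y := by
          intro y hy
          by_contra hcon
          exact hl ⟨h3, ⟨y, hy, by tauto⟩, hall⟩
        have h13 : ∀ z ∈ N H v, 13 ≤ chg H B P v z := by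
          intro z hz
          obtain ⟨k1, k2⟩ := hno z (mem_N.1 hz)
          unfold chg
          rw [if_neg k1, if_neg k2, if_pos e]
          split_ifs <;> omega
        have this : (N H v).card • 13 ≤ ∑ y ∈ N H v, chg H B P v y :=
          Finset.card_nsmul_le_sum (N H v) (chg H B P v) 13 h13
        rw [h3, smul_eq_mul] at this
        omega
      · push Not at hall
        obtain ⟨y, hy, hcase⟩ := hall
        have hb : 18 ≤ chg H B P v y := by
          by_cases h7 : P y ∧ Head H 7 y
          · unfold chg
            rw [if_pos h7.1, if_pos h7.2]
          · obtain ⟨k1, k2, k3⟩ := hcase (fun a b => h7 ⟨a, b⟩)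
            unfold chg
            rw [if_neg k1, if_neg k2, if_pos k3]
            omega
        have := sum_ge (N H v) (chg H B P v) 10 18 y (mem_N.2 hy) hb h10
        rw [h3] at this
        omega
    · have this : (N H v).card • 10 ≤ ∑ y ∈ N H v, chg H B P v y :=
        Finset.card_nsmul_le_sum (N H v) (chg H B P v) 10 h10
      rw [smul_eq_mul] at this
      omega

open Classical in
/-- The total charge paid by `y`. -/
noncomputable def Wt {V : Type} [Fintype V] (H : SimpleGraph V) (B : Finset V) (P : V → Prop)
    (y : V) : ℕ :=
  ∑ v ∈ (N H y).filter (· ∈ B), chg H B P v y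

theorem Wt_zero {V : Type} [Fintype V] {H : SimpleGraph V} {B : Finset V} {P : V → Prop}
    {y : V} (h : ∀ w, H.Adj y w → w ∉ B) : Wt H B P y = 0 := by
  classical
  unfold Wt
  refine Finset.sum_eq_zero ?_
  intro v hv
  rw [Finset.mem_filter, mem_N] at hv
  exact absurd hv.2 (h v hv.1)

theorem Wt_single {V : Type} [Fintype V] {H : SimpleGraph V} {B : Finset V} {P : V → Prop}
    {y v : V} {c : ℕ} (h : ∀ w, H.Adj y w → w ∈ B → w = v) (hc : chg H B P v y ≤ c) :
    Wt H B P y ≤ c := by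
  classical
  refine le_trans ?_ hc
  unfold Wt
  refine (Finset.sum_le_sum_of_subset (t := {v}) ?_).trans (by simp)
  intro w hw
  rw [Finset.mem_filter, mem_N] at hw
  exact Finset.mem_singleton.2 (h w hw.1 hw.2)

theorem Wt_pair {V : Type} [Fintype V] {H : SimpleGraph V} {B : Finset V} {P : V → Prop}
    {y a b : V} {c : ℕ} (hab : a ≠ b) (h : ∀ w, H.Adj y w → w = a ∨ w = b)
    (ha : chg H B P a y ≤ c) (hb : chg H B P b y ≤ c) :
    Wt H B P y ≤ 2 * c := by
  classical
  unfold Wt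
  refine (Finset.sum_le_sum_of_subset (t := {a, b}) ?_).trans ?_
  · intro w hw
    rw [Finset.mem_filter, mem_N] at hw
    simpa using h w hw.1
  · rw [Finset.sum_pair hab]
    omega

theorem lab_three {V : Type} [Fintype V] {H : SimpleGraph V} {B : Finset V} {P : V → Prop}
    {v y : V} (hy : H.Adj v y)
    (h : (P y ∧ Head H 7 y) ∨ (¬ P y ∧ ¬ K1 H B y ∧ T2 H B y)) : lab H B P v = 3 := by
  unfold lab
  rw [if_neg]
  rintro ⟨-, -, h3⟩
  have := h3 y hy
  tauto

/-- The charge at the first vertex of a long thread. -/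
theorem Thread.first {V : Type} [Fintype V] {H : SimpleGraph V} {B : Finset V} {P : V → Prop}
    {k : ℕ} {x : ℕ → V} (T : Thread H B k x) (hk : 3 ≤ k) (hP : ¬ P (x 1)) :
    Wt H B P (x 1) ≤ if lab H B P (x 0) = 3 then 13 else 4 := by
  have a2 : H.Adj (x 1) (x 2) := (T.nbr 1 le_rfl (by omega) _).2 (Or.inr rfl)
  have a3 : H.Adj (x 2) (x 3) := (T.nbr 2 (by omega) (by omega) _).2 (Or.inr rfl)
  have b2 := T.notB 2 (by omega) (by omega)
  have b3 := T.notB 3 (by omega) (by omega)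
  refine Wt_single (v := x 0) ?_ ?_
  · intro w hw hwB
    rcases (T.nbr 1 le_rfl (by omega) w).1 hw with h | h
    · exact h
    · exact absurd (h ▸ hwB) b2
  · have hK : ¬ K1 H B (x 1) := fun h => b2 (h _ a2)
    have hT : ¬ T2 H B (x 1) := by
      rintro ⟨y', h1, h2, h3, h4⟩
      have hy : y' = x 2 := by
        by_contra hne
        exact b2 (h3 _ a2 (Ne.symm hne))
      subst hy
      refine b3 (h4 _ a3 ?_)
      exact (T.ne 2 (by omega) (by omega)).symm
    unfold chg
    rw [if_neg hP, if_neg hK, if_neg hT]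

/-- Threads give pieces. -/
theorem thread_piece {V : Type} [Fintype V] {H : SimpleGraph V} {B : Finset V} {P : V → Prop}
    {k : ℕ} {x : ℕ → V} (hk : 1 ≤ k) (T : Thread H B k x)
    (hP : ∀ i, 1 ≤ i → i ≤ k → ¬ P (x i)) : ∃ C, (∀ y ∈ C, ∃ i, 1 ≤ i ∧ i ≤ k ∧ y = x i) ∧
      C.Nonempty ∧ Piece H B (lab H B P) (Wt H B P) C := by
  classical
  have main : ∀ x : ℕ → V, Piece H B (lab H B P) (Wt H B P) ((Finset.Icc 1 k).image x) →
      (∀ i, 1 ≤ i → i ≤ k → ¬ P (x i)) → ∃ C, (∀ y ∈ C, ∃ i, 1 ≤ i ∧ i ≤ k ∧ y = x i) ∧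
      C.Nonempty ∧ Piece H B (lab H B P) (Wt H B P) C := by
    intro x hx _
    refine ⟨_, ?_, ⟨x 1, Finset.mem_image.2 ⟨1, Finset.mem_Icc.2 ⟨le_rfl, hk⟩, rfl⟩⟩, hx⟩
    intro y hy
    obtain ⟨i, hi, rfl⟩ := Finset.mem_image.1 hy
    exact ⟨i, (Finset.mem_Icc.1 hi).1, (Finset.mem_Icc.1 hi).2, rfl⟩
  have hg : ∀ v ∈ B, lab H B P v = 2 ∨ lab H B P v = 3 := fun v _ => lab_or H B P v
  obtain rfl | rfl | h3 : k = 1 ∨ k = 2 ∨ 3 ≤ k := by omega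
  · refine main x (thread_one T hg ?_) hP
    have hK : K1 H B (x 1) := by
      intro w hw
      rcases (T.nbr 1 le_rfl le_rfl w).1 hw with h | h
      · exact h ▸ T.left
      · exact h ▸ T.right
    have hc : ∀ v, chg H B P v (x 1) ≤ 10 := by
      intro v
      unfold chg
      rw [if_neg (hP 1 le_rfl le_rfl), if_pos hK]
    have := Wt_pair (c := 10) (P := P) (T.ne 1 le_rfl le_rfl)
      (fun w hw => (T.nbr 1 le_rfl le_rfl w).1 hw) (hc _) (hc _)
    omega
  · have key : ∀ x : ℕ → V, Thread H B 2 x → ¬ P (x 1) →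
        lab H B P (x 0) = 3 ∧ Wt H B P (x 1) ≤ 22 := by
      intro x T hP1
      have a0 : H.Adj (x 1) (x 0) := (T.nbr 1 le_rfl (by omega) _).2 (Or.inl rfl)
      have a2 : H.Adj (x 1) (x 2) := (T.nbr 1 le_rfl (by omega) _).2 (Or.inr rfl)
      have b2 := T.notB 2 (by omega) (by omega)
      have hK : ¬ K1 H B (x 1) := fun h => b2 (h _ a2)
      have hT : T2 H B (x 1) := by
        refine ⟨x 2, a2, b2, ?_, ?_⟩
        · intro w hw hne
          rcases (T.nbr 1 le_rfl (by omega) w).1 hw with h | h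
          · exact h ▸ T.left
          · exact absurd h hne
        · intro w hw hne
          rcases (T.nbr 2 (by omega) le_rfl w).1 hw with h | h
          · exact absurd h hne
          · exact h ▸ T.right
      refine ⟨lab_three a0.symm (Or.inr ⟨hP1, hK, hT⟩), Wt_single (v := x 0) ?_ ?_⟩
      · intro w hw hwB
        rcases (T.nbr 1 le_rfl (by omega) w).1 hw with h | h
        · exact h
        · exact absurd (h ▸ hwB) b2
      · unfold chg
        rw [if_neg hP1, if_neg hK, if_pos hT]
    obtain ⟨k1, k2⟩ := key x T (hP 1 le_rfl (by omega))
    obtain ⟨k3, k4⟩ := key _ T.rev (hP 2 (by omega) (by omega))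
    exact main x (thread_two T k1 k3 k2 k4) hP
  · have hW0 : ∀ i, 1 < i → i < k → Wt H B P (x i) = 0 := by
      intro i h1 h2
      refine Wt_zero ?_
      intro w hw
      rcases (T.nbr i (by omega) (by omega) w).1 hw with h | h
      · exact h ▸ T.notB (i - 1) (by omega) (by omega)
      · exact h ▸ T.notB (i + 1) (by omega) (by omega)
    have hW1 := T.first h3 (hP 1 le_rfl hk)
    have hWk := T.rev.first (P := P) h3 (hP k hk le_rfl)
    simp only [Nat.add_sub_cancel, Nat.sub_zero] at hWk
    by_cases hor : lab H B P (x (k + 1)) = 3 ∨ lab H B P (x 0) = 2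
    · exact main x (thread_long h3 T hg hW0 hW1 hWk hor) hP
    · have hor' : lab H B P (x 0) = 3 ∨ lab H B P (x (k + 1)) = 2 := by
        have := lab_or H B P (x 0)
        have := lab_or H B P (x (k + 1))
        tauto
      obtain ⟨C, h1, h2, h3⟩ := main (fun i => x (k + 1 - i))
        (thread_long h3 T.rev hg (fun i h1 h2 => hW0 _ (by omega) (by omega))
          (by simpa using hWk) (by simpa using hW1) (by simpa using hor'))
        (fun i h1 h2 => hP _ (by omega) (by omega))
      refine ⟨C, ?_, h2, h3⟩
      intro y hy
      obtain ⟨i, i1, i2, rfl⟩ := h1 y hy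
      exact ⟨k + 1 - i, by omega, by omega, rfl⟩

/-- Components with a chord give pieces. -/
theorem cv_piece {V : Type} [Fintype V] {H : SimpleGraph V} {B S : Finset V} {P : V → Prop}
    {n : ℕ} [NeZero n] (hr : ∀ a : Fin n, a.val • (1 : Fin n) = a)
    (hpat : ∀ j : Fin n, j ≠ 0 → j ≠ 1 → j ≠ -1 →
      ∃ p : Fin n → ℕ, (∀ i, PatOK (EC n j) p i) ∧ ∑ i, p i ≤ n)
    (hCB : ∀ v, CV H n v → v ∉ B)
    (hcl : ∀ y ∈ S, ∀ w, H.Adj y w → w ∈ S ∨ w ∈ B) {y : V} (hy : y ∈ S) (hC : CV H n y) :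
    ∃ C ⊆ S, C.Nonempty ∧ Piece H B (lab H B P) (Wt H B P) C := by
  classical
  obtain ⟨x, v, A, hv, ⟨i, rfl⟩⟩ := hC
  have hcv : ∀ i, CV H n (x i) := fun i => ⟨x, v, A, hv, ⟨i, rfl⟩⟩
  have hmem : ∀ j, x j ∈ S := by
    intro j
    refine around (S := (S : Set V)) hr ?_ i hy j
    intro i hi
    rcases hcl _ hi _ (A.adj i) with h | h
    · exact h
    · exact absurd h (hCB _ (hcv _))
  refine ⟨Finset.univ.image x, ?_, ⟨x i, Finset.mem_image.2 ⟨i, Finset.mem_univ _, rfl⟩⟩, ?_⟩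
  · intro z hz
    obtain ⟨j, -, rfl⟩ := Finset.mem_image.1 hz
    exact hmem j
  · exact chord_piece hpat A hv (fun i => hCB _ (hcv i))
      (fun i => Wt_zero (fun w hw => hCB _ ((hcv i).adj hw)))

/-- Common facts for pendant cycles. -/
theorem pend_facts {V : Type} [Fintype V] {H : SimpleGraph V} {B S : Finset V} {P : V → Prop}
    {n : ℕ} [NeZero n] (hr : ∀ a : Fin n, a.val • (1 : Fin n) = a)
    (h10 : (1 : Fin n) ≠ 0)
    (hB3 : ∀ v ∈ B, 3 ≤ (N H v).card) {x : Fin n → V} {v : V} (hPB : x 0 ∉ B)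
    (hcl : ∀ y ∈ S, ∀ w, H.Adj y w → w ∈ S ∨ w ∈ B) (hy : x 0 ∈ S)
    (A : Att H n x v) (hv : v ∉ Set.range x) :
    (∀ i, x i ∉ B) ∧ (∀ i, x i ∈ S) ∧ (∀ i, i ≠ 0 → Wt H B P (x i) = 0) ∧
      (∀ w, H.Adj (x 0) w → w ∈ B → w = v) := by
  have hB : ∀ i, x i ∉ B := by
    intro i hi
    by_cases h : i = 0
    · exact hPB (h ▸ hi)
    · have := A.deg_le hv i h
      have := hB3 _ hi
      omega
  refine ⟨hB, ?_, ?_, ?_⟩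
  · intro j
    refine around (S := (S : Set V)) hr ?_ 0 hy j
    intro i hi
    rcases hcl _ hi _ (A.adj i) with h | h
    · exact h
    · exact absurd h (hB _)
  · intro i hi
    refine Wt_zero ?_
    intro w hw
    rcases A.nbr i w hw with h | h | ⟨h, -⟩ | ⟨h, -⟩
    · exact h ▸ hB _
    · exact h ▸ hB _
    · exact absurd h hi
    · exact absurd ⟨i, h⟩ hv
  · intro w hw hwB
    exact A.uniq hv h10 w hw (hB3 w hwB)

/-- The main estimate for edge-minimal graphs. -/
theorem core {V : Type} [Fintype V] (H : SimpleGraph V) (hdeg : ∀ v, 2 ≤ (N H v).card)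
    (h5 : ∀ x, ¬ Cyc H 5 x) (h7 : ∀ x, ¬ Cyc H 7 x) (hmin : EdgeMin H) :
    ∃ f : V → ℕ, (∀ y, Good H f y) ∧ 20 * ∑ y, f y ≤ 22 * Fintype.card V := by
  classical
  obtain ⟨P, B, hB, hind, hP, hPP⟩ := exists_choice H hmin
  have hB3 : ∀ v ∈ B, 3 ≤ (N H v).card := fun v hv => ((hB v).1 hv).1
  have hPB : ∀ u, P u → u ∉ B := fun u hu h => ((hB u).1 h).2.2 hu
  have hadjB : ∀ u v, P u → H.Adj u v → 3 ≤ (N H v).card → v ∈ B := by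
    intro u v hu huv hv
    refine (hB v).2 ⟨hv, ?_, fun h => hPP u v hu h huv⟩
    rintro (h | h)
    · exact (hP u hu).2 (Or.inl (h.adj huv.symm))
    · exact (hP u hu).2 (Or.inr (h.adj huv.symm))
  have hW : ∀ y, Wt H B P y = ∑ v ∈ (N H y).filter (· ∈ B), chg H B P v y := by
    intro y
    unfold Wt
    congr!
  refine account (H := H) (B := B) (g := lab H B P) (W := Wt H B P) (h := chg H B P) (by
    intro y; rw [hW y]) hind
    ?_ (fun v _ => lab_or H B P v) (fun v hv => lab_le H B P v (hB3 v hv))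
  have hsub : Piece H B (lab H B P) (Wt H B P) (Finset.univ \ B) := by
    refine piece_merge H B (lab H B P) (Wt H B P) ?_ _ _ rfl ?_ ?_
    · intro S hne hSB hcl
      by_cases c5 : ∃ y ∈ S, CV H 5 y
      · obtain ⟨y, hy, hc⟩ := c5
        exact cv_piece hr5 chord_pat5 (fun v h hv => ((hB v).1 hv).2.1 (Or.inl h)) hcl hy hc
      by_cases c7 : ∃ y ∈ S, CV H 7 y
      · obtain ⟨y, hy, hc⟩ := c7
        exact cv_piece hr7 chord_pat7 (fun v h hv => ((hB v).1 hv).2.1 (Or.inr h)) hcl hy hc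
      by_cases cP : ∃ u ∈ S, P u
      · obtain ⟨u, hu, hPu⟩ := cP
        by_cases hd7 : Head H 7 u
        · obtain ⟨x, v, rfl, A, hv, hv3⟩ := id hd7
          obtain ⟨f1, f2, f3, f4⟩ := pend_facts (P := P) hr7 (by decide) hB3 (hPB _ hPu) hcl hu A hv
          refine ⟨Finset.univ.image x, ?_, ⟨x 0, Finset.mem_image.2 ⟨0, Finset.mem_univ _, rfl⟩⟩,
            pend_piece7 A hv f1 (hadjB _ v hPu A.ext hv3)
              (lab_three A.ext.symm (Or.inl ⟨hPu, hd7⟩)) f3 (Wt_single f4 ?_)⟩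
          · intro z hz
            obtain ⟨j, -, rfl⟩ := Finset.mem_image.1 hz
            exact f2 j
          · unfold chg
            rw [if_pos hPu, if_pos hd7]
        · obtain ⟨x, v, rfl, A, hv, hv3⟩ := (hP u hPu).1.resolve_right hd7
          obtain ⟨f1, f2, f3, f4⟩ := pend_facts (P := P) hr5 (by decide) hB3 (hPB _ hPu) hcl hu A hv
          refine ⟨Finset.univ.image x, ?_, ⟨x 0, Finset.mem_image.2 ⟨0, Finset.mem_univ _, rfl⟩⟩,
            pend_piece5 A hv f1 (hadjB _ v hPu A.ext hv3)
              (lab_or H B P v) f3 (Wt_single f4 ?_)⟩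
          · intro z hz
            obtain ⟨j, -, rfl⟩ := Finset.mem_image.1 hz
            exact f2 j
          · unfold chg
            rw [if_pos hPu, if_neg hd7]
      push Not at c5 c7 cP
      have hd2 : ∀ y ∈ S, (N H y).card = 2 := by
        intro y hy
        by_contra hne
        have := hdeg y
        refine hSB y hy ((hB y).2 ⟨by omega, ?_, cP y hy⟩)
        rintro (h | h)
        · exact c5 y hy h
        · exact c7 y hy h
      obtain ⟨k, x, hk, hxS, T | ⟨hk3, Q, ha⟩⟩ := thread_or_cycle hne hSB hcl hd2
      · obtain ⟨C, h1, h2, h3⟩ := thread_piece hk T (fun i i1 i2 => cP _ (hxS i i1 i2))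
        refine ⟨C, ?_, h2, h3⟩
        intro y hy
        obtain ⟨i, i1, i2, rfl⟩ := h1 y hy
        exact hxS i i1 i2
      · have hnb : ∀ i, 1 ≤ i → i ≤ k → ∀ w, H.Adj (x i) w → ∃ j, 1 ≤ j ∧ j ≤ k ∧ w = x j := by
          intro i i1 i2 w hw
          have hs : ∃ j, 1 ≤ j ∧ j ≤ k ∧ H.Adj (x i) (x j) ∧ (j = i + 1 ∨ (i = k ∧ j = 1)) := by
            by_cases h : i = k
            · subst h
              exact ⟨1, le_rfl, hk, ha, Or.inr ⟨rfl, rfl⟩⟩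
            · exact ⟨i + 1, by omega, by omega, Q.adj i i1 (by omega), Or.inl rfl⟩
          have hp : ∃ j, 1 ≤ j ∧ j ≤ k ∧ H.Adj (x i) (x j) ∧ (i = j + 1 ∨ (j = k ∧ i = 1)) := by
            by_cases h : i = 1
            · subst h
              exact ⟨k, hk, le_rfl, ha.symm, Or.inr ⟨rfl, rfl⟩⟩
            · have := Q.adj (i - 1) (by omega) (by omega)
              rw [show i - 1 + 1 = i by omega] at this
              exact ⟨i - 1, by omega, by omega, this.symm, Or.inl (by omega)⟩
          obtain ⟨j, j1, j2, j3, j4⟩ := hs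
          obtain ⟨l, l1, l2, l3, l4⟩ := hp
          have hjl : x j ≠ x l := by
            intro h
            have := Q.inj ⟨j1, j2⟩ ⟨l1, l2⟩ h
            omega
          rcases (two_nbrs (hd2 _ (hxS i i1 i2)) j3 l3 hjl w).1 hw with h | h
          · exact ⟨j, j1, j2, h⟩
          · exact ⟨l, l1, l2, h⟩
        refine ⟨(Finset.Icc 1 k).image x, ?_,
          ⟨x 1, Finset.mem_image.2 ⟨1, Finset.mem_Icc.2 ⟨le_rfl, hk⟩, rfl⟩⟩,
          cycle_piece hk3 ?_ ?_ Q.inj (fun i i1 i2 => hSB _ (hxS i i1 i2)) Q.adj ha hnb ?_⟩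
        · intro z hz
          obtain ⟨j, hj, rfl⟩ := Finset.mem_image.1 hz
          exact hxS j (Finset.mem_Icc.1 hj).1 (Finset.mem_Icc.1 hj).2
        · rintro rfl
          exact h5 _ (cyc_of_path hk3 Q ha hd2 (by decide))
        · rintro rfl
          exact h7 _ (cyc_of_path hk3 Q ha hd2 (by decide))
        · intro i i1 i2
          refine Wt_zero ?_
          intro w hw
          obtain ⟨j, j1, j2, rfl⟩ := hnb i i1 i2 w hw
          exact hSB _ (hxS j j1 j2)
    · intro y hy
      exact (Finset.mem_sdiff.1 hy).2
    · intro y _ w _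
      by_cases h : w ∈ B
      · exact Or.inr h
      · exact Or.inl (Finset.mem_sdiff.2 ⟨Finset.mem_univ _, h⟩)
  convert hsub

/-- Rotating a cycle. -/
theorem Cyc.rotate {V : Type} {H : SimpleGraph V} {n : ℕ} [NeZero n] {x : Fin n → V}
    (h : Cyc H n x) (a : Fin n) : Cyc H n (fun i => x (i + a)) := by
  refine ⟨fun i j hij => add_right_cancel (h.1 hij), fun i w => ?_⟩
  have := h.2 (i + a) w
  beta_reduce
  rw [show i + 1 + a = i + a + 1 by abel, show i - 1 + a = i + a - 1 by abel]
  exact this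

/-- A cycle component of `H - uv` through `u`. -/
theorem att_of_cyc {V : Type} {H H' : SimpleGraph V} {n : ℕ} [NeZero n] {u v : V}
    (hH : ∀ a b, H'.Adj a b ↔ H.Adj a b ∧ ¬ ((a = u ∧ b = v) ∨ (a = v ∧ b = u)))
    (huv : H.Adj u v) {x : Fin n → V} (hx : Cyc H' n x) (h0 : x 0 = u) : Att H n x v := by
  have hadj : ∀ i, H'.Adj (x i) (x (i + 1)) := fun i => (hx.2 i _).2 (Or.inl rfl)
  have hnot : ¬ H'.Adj (x 0) v := by
    rw [hH, h0]
    tauto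
  refine ⟨hx.1, fun i => ((hH _ _).1 (hadj i)).1, h0 ▸ huv, ?_, ?_, ?_⟩
  · rintro rfl
    refine hnot ?_
    have := hadj 0
    rwa [zero_add] at this
  · rintro rfl
    refine hnot ?_
    have := hadj (-1)
    rw [neg_add_cancel] at this
    exact this.symm
  · intro i w hw
    by_cases h : H'.Adj (x i) w
    · rcases (hx.2 i w).1 h with h | h
      · exact Or.inl h
      · exact Or.inr (Or.inl h)
    · rw [hH] at h
      have h' : (x i = u ∧ w = v) ∨ (x i = v ∧ w = u) := by
        by_contra hc
        exact h ⟨hw, hc⟩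
      rcases h' with ⟨h1, h2⟩ | ⟨h1, h2⟩
      · exact Or.inr (Or.inr (Or.inl ⟨hx.1 (h1.trans h0.symm), h2⟩))
      · exact Or.inr (Or.inr (Or.inr ⟨h1, h2.trans h0.symm⟩))

theorem att_exists {V : Type} {H H' : SimpleGraph V} {n : ℕ} [NeZero n] {u v : V}
    (hH : ∀ a b, H'.Adj a b ↔ H.Adj a b ∧ ¬ ((a = u ∧ b = v) ∨ (a = v ∧ b = u)))
    (huv : H.Adj u v) {x : Fin n → V} (hx : Cyc H' n x) (hno : ¬ Cyc H n x) :
    ∃ x : Fin n → V, (x 0 = u ∧ Att H n x v) ∨ (x 0 = v ∧ Att H n x u) := by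
  by_cases hu : u ∈ Set.range x
  · obtain ⟨a, ha⟩ := hu
    have h0 : (fun i => x (i + a)) 0 = u := by simpa using ha
    exact ⟨_, Or.inl ⟨h0, att_of_cyc hH huv (hx.rotate a) h0⟩⟩
  by_cases hv : v ∈ Set.range x
  · obtain ⟨a, ha⟩ := hv
    have h0 : (fun i => x (i + a)) 0 = v := by simpa using ha
    refine ⟨_, Or.inr ⟨h0, att_of_cyc (H' := H') ?_ huv.symm (hx.rotate a) h0⟩⟩
    intro a b
    rw [hH]
    tauto
  · exfalso
    refine hno ⟨hx.1, fun i w => ?_⟩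
    rw [← hx.2 i w, hH]
    have h1 : x i ≠ u := fun h => hu ⟨i, h⟩
    have h2 : x i ≠ v := fun h => hv ⟨i, h⟩
    tauto

/-- Existence of an edge-minimal spanning subgraph. -/
theorem exists_min {V : Type} [Fintype V] (G : SimpleGraph V) (hdeg : ∀ v, 2 ≤ (N G v).card)
    (h5 : ∀ x, ¬ Cyc G 5 x) (h7 : ∀ x, ¬ Cyc G 7 x) :
    ∃ H ≤ G, (∀ v, 2 ≤ (N H v).card) ∧ (∀ x, ¬ Cyc H 5 x) ∧ (∀ x, ¬ Cyc H 7 x) ∧ EdgeMin H := by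
  classical
  obtain ⟨H, ⟨hHG, hd, k5, k7⟩, hmin⟩ := (wellFounded_lt (α := SimpleGraph V)).has_min
    {H | H ≤ G ∧ (∀ v, 2 ≤ (N H v).card) ∧ (∀ x, ¬ Cyc H 5 x) ∧ (∀ x, ¬ Cyc H 7 x)}
    ⟨G, le_rfl, hdeg, h5, h7⟩
  refine ⟨H, hHG, hd, k5, k7, ?_⟩
  intro u v huv hu hv
  have hH : ∀ a b, (H.deleteEdges {s(u, v)}).Adj a b ↔
      H.Adj a b ∧ ¬ ((a = u ∧ b = v) ∨ (a = v ∧ b = u)) := by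
    intro a b
    rw [SimpleGraph.deleteEdges_adj, Set.mem_singleton_iff, Sym2.eq_iff]
  generalize hgen : H.deleteEdges {s(u, v)} = H' at hH
  have hle : H' ≤ H := fun a b h => ((hH a b).1 h).1
  have hlt : H' < H := by
    refine lt_of_le_of_ne hle ?_
    intro h
    have := (hH u v).1 (h ▸ huv)
    tauto
  have hd' : ∀ w, 2 ≤ (N H' w).card := by
    intro w
    by_cases hwu : w = u
    · have : (N H w).erase v ⊆ N H' w := by
        intro z hz
        rw [Finset.mem_erase, mem_N] at hz
        rw [mem_N, hH]
        refine ⟨hz.2, ?_⟩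
        rintro (⟨-, h⟩ | ⟨h, -⟩)
        · exact hz.1 h
        · exact huv.ne (hwu.symm.trans h)
      have h1 := Finset.card_le_card this
      have h2 := Finset.pred_card_le_card_erase (s := N H w) (a := v)
      rw [hwu] at h1 h2 ⊢
      omega
    by_cases hwv : w = v
    · have : (N H w).erase u ⊆ N H' w := by
        intro z hz
        rw [Finset.mem_erase, mem_N] at hz
        rw [mem_N, hH]
        refine ⟨hz.2, ?_⟩
        rintro (⟨h, -⟩ | ⟨-, h⟩)
        · exact hwu h
        · exact hz.1 h
      have h1 := Finset.card_le_card this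
      have h2 := Finset.pred_card_le_card_erase (s := N H w) (a := u)
      rw [hwv] at h1 h2 ⊢
      omega
    · refine (hd w).trans (Finset.card_le_card ?_)
      intro z hz
      rw [mem_N] at hz
      rw [mem_N, hH]
      tauto
  by_contra hcon
  refine hmin H' ⟨hle.trans hHG, hd', ?_, ?_⟩ hlt
  · intro x hx
    exact hcon (Or.inl (att_exists hH huv hx (k5 x)))
  · intro x hx
    exact hcon (Or.inr (att_exists hH huv hx (k7 x)))

/-- Cycle components are components isomorphic to a cycle. -/
theorem iso_of_cyc {V : Type} {G : SimpleGraph V} {n : ℕ} [NeZero n] {x : Fin n → V}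
    (hr : ∀ a : Fin n, a.val • (1 : Fin n) = a)
    (hc : ∀ i j : Fin n, (j = i + 1 ∨ j = i - 1) ↔ (cycleG n).Adj i j) (hx : Cyc G n x) :
    ∃ c : G.ConnectedComponent, Nonempty (G.induce c.supp ≃g cycleG n) := by
  have h1 : ∀ j, G.Reachable (x 0) (x j) := by
    intro j
    refine around (S := {y | G.Reachable (x 0) y}) hr ?_ 0 (SimpleGraph.Reachable.refl _) j
    intro i hi
    exact SimpleGraph.Reachable.trans hi ((hx.2 i _).2 (Or.inl rfl)).reachable
  have h2 : ∀ y, G.Reachable (x 0) y → ∃ j, x j = y := by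
    intro y hy
    rw [SimpleGraph.reachable_iff_reflTransGen] at hy
    induction hy with
    | refl => exact ⟨0, rfl⟩
    | tail _ hbc ih =>
      obtain ⟨j, rfl⟩ := ih
      rcases (hx.2 j _).1 hbc with h | h
      · exact ⟨_, h.symm⟩
      · exact ⟨_, h.symm⟩
  refine ⟨G.connectedComponentMk (x 0), ⟨?_⟩⟩
  have hm : ∀ y, y ∈ (G.connectedComponentMk (x 0)).supp ↔ G.Reachable (x 0) y := by
    intro y
    rw [SimpleGraph.ConnectedComponent.mem_supp_iff, SimpleGraph.ConnectedComponent.eq]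
    exact ⟨fun h => h.symm, fun h => h.symm⟩
  let e : Fin n ≃ (G.connectedComponentMk (x 0)).supp :=
    Equiv.ofBijective (fun i => ⟨x i, (hm _).2 (h1 i)⟩) (by
      constructor
      · intro i j hij
        exact hx.1 (congrArg Subtype.val hij)
      · rintro ⟨y, hy⟩
        obtain ⟨j, rfl⟩ := h2 y ((hm y).1 hy)
        exact ⟨j, rfl⟩)
  refine SimpleGraph.Iso.symm ⟨e, ?_⟩
  intro i j
  rw [← hc i j]
  change G.Adj (x i) (x j) ↔ _
  rw [hx.2 i (x j), hx.1.eq_iff, hx.1.eq_iff]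

theorem cycle5 : ∀ i j : Fin 5, (j = i + 1 ∨ j = i - 1) ↔ (cycleG 5).Adj i j := by
  simp only [cycleG, SimpleGraph.fromRel_adj]
  decide

theorem cycle7 : ∀ i j : Fin 7, (j = i + 1 ∨ j = i - 1) ↔ (cycleG 7).Adj i j := by
  simp only [cycleG, SimpleGraph.fromRel_adj]
  decide

theorem Good.mono {V : Type} {H G : SimpleGraph V} (h : H ≤ G) {f : V → ℕ} {y : V}
    (hg : Good H f y) : Good G f y := by
  refine ⟨hg.1, ?_, ?_⟩
  · intro h0
    rcases hg.2.1 h0 with ⟨u, w, h1, h2, h3, h4⟩ | ⟨u, h1, h2⟩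
    · exact Or.inl ⟨u, w, h1, h h2, h h3, h4⟩
    · exact Or.inr ⟨u, h h1, h2⟩
  · intro h0
    obtain ⟨u, h1, h2⟩ := hg.2.2 h0
    exact ⟨u, h h1, h2⟩

end DR

/-- Let `G` be a graph of order `n ≥ 5` with minimum degree at least `2` and with no
component isomorphic to `C_5` or `C_7`.  Then `γ_dR(G) ≤ 11n/10`. -/
theorem gammaDR_le_eleven_tenths {V : Type} [Fintype V] (G : SimpleGraph V)
    (hn : 5 ≤ Fintype.card V)
    (hdeg : ∀ v, 2 ≤ {w | G.Adj v w}.ncard)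
    (hC5 : ∀ c : G.ConnectedComponent, ¬ Nonempty (G.induce c.supp ≃g cycleG 5))
    (hC7 : ∀ c : G.ConnectedComponent, ¬ Nonempty (G.induce c.supp ≃g cycleG 7)) :
    (gammaDR G : ℚ) ≤ 11 * (Fintype.card V) / 10 := by
  have hdeg' : ∀ v, 2 ≤ (DR.N G v).card := by
    intro v
    have h := hdeg v
    have e : {w | G.Adj v w} = (DR.N G v : Set V) := by
      ext w
      rw [Finset.mem_coe, DR.mem_N, Set.mem_ofPred_eq]
    rwa [e, Set.ncard_coe_finset] at h
  have k5 : ∀ x, ¬ DR.Cyc G 5 x := by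
    intro x hx
    obtain ⟨c, hc⟩ := DR.iso_of_cyc DR.hr5 DR.cycle5 hx
    exact hC5 c hc
  have k7 : ∀ x, ¬ DR.Cyc G 7 x := by
    intro x hx
    obtain ⟨c, hc⟩ := DR.iso_of_cyc DR.hr7 DR.cycle7 hx
    exact hC7 c hc
  obtain ⟨H, hHG, hd, h5, h7, hmin⟩ := DR.exists_min G hdeg' k5 k7
  obtain ⟨f, hf, hle⟩ := DR.core H hd h5 h7 hmin
  have hD : IsDRDF G f :=
    ⟨fun v => ((hf v).mono hHG).1, fun v => ((hf v).mono hHG).2.1,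
      fun v => ((hf v).mono hHG).2.2⟩
  have hle2 : gammaDR G ≤ ∑ v, f v := Nat.sInf_le ⟨f, hD, rfl⟩
  have h3 : 10 * gammaDR G ≤ 11 * Fintype.card V := by omega
  have h4 : (10 : ℚ) * gammaDR G ≤ 11 * Fintype.card V := by exact_mod_cast h3
  linarith
end
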